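/- Suppose n ≥ 3, α ∈ (0,n), 0 < λ < (n−α)/(n−2), and σ = g_α(λ) = n/(n−2). Then every nonnegative solution u of the Choquard–Pekar inequality problem is harmonically bounded at 0; that is, u(x) = O(|x|^{-(n-2)}) as x → 0. -/

import Mathlib

open MeasureTheory Metric Filter Set Asymptotics Topology

/-- `ℝⁿ` as a Euclidean space. -/
abbrev Euc (n : ℕ) : Type := EuclideanSpace ℝ (Fin n)

/-- The Laplacian `Δu(x) = ∑ i ∂²u/∂xᵢ²(x)`. -/
noncomputable def lap {n : ℕ} (u : Euc n → ℝ) (x : Euc n) : ℝ :=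
  ∑ i : Fin n, iteratedFDeriv ℝ 2 u x ![EuclideanSpace.single i 1, EuclideanSpace.single i 1]

/-- `u` is a nonnegative solution of the Choquard–Pekar inequality problem:
`u ∈ C²(ℝⁿ \ {0}) ∩ L^λ(ℝⁿ)` and
`0 ≤ -Δu(x) ≤ (∫ |x-y|^(-α) u(y)^λ dy) · u(x)^σ` on `B₂(0) \ {0}`. -/
def IsCPSolution (n : ℕ) (α lam sig : ℝ) (u : Euc n → ℝ) : Prop :=
  (∀ x, 0 ≤ u x) ∧
  ContDiffOn ℝ 2 u {0}ᶜ ∧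
  Integrable (fun y => u y ^ lam) ∧
  ∀ x ∈ ball (0 : Euc n) 2 \ {0},
    0 ≤ -lap u x ∧
    -lap u x ≤ (∫ y, ‖x - y‖ ^ (-α) * u y ^ lam) * u x ^ sig

lemma continuous_mul_of_tsupport_subset {n : ℕ} {Ω : Set (Euc n)} (hΩ : IsOpen Ω)
    {h g : Euc n → ℝ} (hh : ContinuousOn h Ω) (hg : Continuous g) (hs : tsupport g ⊆ Ω) :
    Continuous fun x => h x * g x := by
  refine continuous_of_tsupport fun x hx => ?_
  have hx' : x ∈ tsupport g := by
    refine closure_mono (fun y hy => ?_) hx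
    exact fun h0 => hy (by simp [h0])
  exact (hh.continuousAt (hΩ.mem_nhds (hs hx'))).mul hg.continuousAt

lemma integrable_mul_of_tsupport_subset {n : ℕ} {Ω : Set (Euc n)} (hΩ : IsOpen Ω)
    {h g : Euc n → ℝ} (hh : ContinuousOn h Ω) (hg : Continuous g) (hc : HasCompactSupport g)
    (hs : tsupport g ⊆ Ω) : Integrable fun x => h x * g x :=
  (continuous_mul_of_tsupport_subset hΩ hh hg hs).integrable_of_hasCompactSupport hc.mul_left

lemma fderiv_fderiv_apply {n : ℕ} {u : Euc n → ℝ} {x : Euc n} (hu : ContDiffAt ℝ 2 u x)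
    (v w : Euc n) : fderiv ℝ (fun y => fderiv ℝ u y v) x w = fderiv ℝ (fderiv ℝ u) x w v := by
  have h : DifferentiableAt ℝ (fderiv ℝ u) x :=
    (hu.fderiv_right (m := 1) (by norm_num)).differentiableAt (by norm_num)
  rw [fderiv_clm_apply h (differentiableAt_const v)]
  simp

lemma lap_eq_sum {n : ℕ} {u : Euc n → ℝ} {x : Euc n} (hu : ContDiffAt ℝ 2 u x) :
    lap u x = ∑ i : Fin n, fderiv ℝ (fun y => fderiv ℝ u y (EuclideanSpace.single i 1)) x
      (EuclideanSpace.single i 1) := by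
  simp only [lap, iteratedFDeriv_two_apply, fderiv_fderiv_apply hu]
  rfl

lemma continuousOn_fderiv_fderiv {n : ℕ} {Ω : Set (Euc n)} (hΩ : IsOpen Ω) {u : Euc n → ℝ}
    (hu : ContDiffOn ℝ 2 u Ω) (v w : Euc n) :
    ContinuousOn (fun x => fderiv ℝ (fun y => fderiv ℝ u y v) x w) Ω := by
  have h1 : ContDiffOn ℝ 1 (fun y => fderiv ℝ u y v) Ω :=
    (hu.fderiv_of_isOpen hΩ (by norm_num)).clm_apply contDiffOn_const
  exact (h1.continuousOn_fderiv_of_isOpen hΩ le_rfl).clm_apply continuousOn_const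

lemma continuousOn_lap {n : ℕ} {Ω : Set (Euc n)} (hΩ : IsOpen Ω) {u : Euc n → ℝ}
    (hu : ContDiffOn ℝ 2 u Ω) : ContinuousOn (lap u) Ω := by
  have h : ContinuousOn (fun x => ∑ i : Fin n,
      fderiv ℝ (fun y => fderiv ℝ u y (EuclideanSpace.single i 1)) x
        (EuclideanSpace.single i 1)) Ω :=
    continuousOn_finsetSum _ fun i _ => continuousOn_fderiv_fderiv hΩ hu _ _
  exact h.congr fun x hx => lap_eq_sum (hu.contDiffAt (hΩ.mem_nhds hx))

/-- Green's second identity against a compactly supported test function. -/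
lemma integral_mul_lap_eq {n : ℕ} {Ω : Set (Euc n)} (hΩ : IsOpen Ω) {u φ : Euc n → ℝ}
    (hu : ContDiffOn ℝ 2 u Ω) (hφ : ContDiff ℝ 2 φ) (hc : HasCompactSupport φ)
    (hs : tsupport φ ⊆ Ω) : ∫ x, u x * lap φ x = ∫ x, lap u x * φ x := by
  have huc : ContinuousOn u Ω := hu.continuousOn
  have hud : ∀ x ∈ Ω, ContDiffAt ℝ 2 u x := fun x hx => hu.contDiffAt (hΩ.mem_nhds hx)
  have hφ1 : ∀ v : Euc n, ContDiff ℝ 1 fun x => fderiv ℝ φ x v := fun v =>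
    (hφ.fderiv_right (by norm_num)).clm_apply contDiff_const
  have hφ2 : ∀ v : Euc n, Continuous fun x => fderiv ℝ (fun y => fderiv ℝ φ y v) x v := fun v =>
    ((hφ1 v).continuous_fderiv one_ne_zero).clm_apply continuous_const
  have hc1 : ∀ v : Euc n, HasCompactSupport fun x => fderiv ℝ φ x v := fun v =>
    hc.fderiv_apply ℝ v
  have hs1 : ∀ v : Euc n, tsupport (fun x => fderiv ℝ φ x v) ⊆ tsupport φ := fun v =>
    tsupport_fderiv_apply_subset ℝ v
  have hc2 : ∀ v : Euc n, HasCompactSupport fun x => fderiv ℝ (fun y => fderiv ℝ φ y v) x v :=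
    fun v => (hc1 v).fderiv_apply ℝ v
  have hs2 : ∀ v : Euc n, tsupport (fun x => fderiv ℝ (fun y => fderiv ℝ φ y v) x v) ⊆
      tsupport φ := fun v => (tsupport_fderiv_apply_subset ℝ v).trans (hs1 v)
  have hu1 : ∀ v : Euc n, ContDiffOn ℝ 1 (fun x => fderiv ℝ u x v) Ω := fun v =>
    (hu.fderiv_of_isOpen hΩ (by norm_num)).clm_apply contDiffOn_const
  have hu2 := continuousOn_fderiv_fderiv hΩ hu
  have key : ∀ v : Euc n, ∫ x, u x * fderiv ℝ (fun y => fderiv ℝ φ y v) x v =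
      ∫ x, fderiv ℝ (fun y => fderiv ℝ u y v) x v * φ x := by
    intro v
    rw [integral_mul_fderiv_eq_neg_fderiv_mul_of_integrable
      (integrable_mul_of_tsupport_subset hΩ (hu1 v).continuousOn (hφ1 v).continuous (hc1 v)
        ((hs1 v).trans hs))
      (integrable_mul_of_tsupport_subset hΩ huc (hφ2 v) (hc2 v) ((hs2 v).trans hs))
      (integrable_mul_of_tsupport_subset hΩ huc (hφ1 v).continuous (hc1 v) ((hs1 v).trans hs))
      (fun x hx => (hud x (hs (hs1 v hx))).differentiableAt (by norm_num))
      (fun x _ => (hφ1 v).differentiable (by norm_num) x),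
      integral_mul_fderiv_eq_neg_fderiv_mul_of_integrable
      (integrable_mul_of_tsupport_subset hΩ (hu2 v v) hφ.continuous hc hs)
      (integrable_mul_of_tsupport_subset hΩ (hu1 v).continuousOn (hφ1 v).continuous (hc1 v)
        ((hs1 v).trans hs))
      (integrable_mul_of_tsupport_subset hΩ (hu1 v).continuousOn hφ.continuous hc hs)
      (fun x hx => ((hu1 v).contDiffAt (hΩ.mem_nhds (hs hx))).differentiableAt (by norm_num))
      (fun x _ => hφ.differentiable (by norm_num) x), neg_neg]
  have e1 : ∀ x, u x * lap φ x = ∑ i : Fin n, u x *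
      fderiv ℝ (fun y => fderiv ℝ φ y (EuclideanSpace.single i 1)) x
        (EuclideanSpace.single i 1) := fun x => by
    rw [lap_eq_sum hφ.contDiffAt, Finset.mul_sum]
  have e2 : ∀ x, lap u x * φ x = ∑ i : Fin n,
      fderiv ℝ (fun y => fderiv ℝ u y (EuclideanSpace.single i 1)) x
        (EuclideanSpace.single i 1) * φ x := fun x => by
    by_cases hx : x ∈ tsupport φ
    · rw [lap_eq_sum (hud x (hs hx)), Finset.sum_mul]
    · simp [image_eq_zero_of_notMem_tsupport hx]
  simp only [e1, e2]
  rw [integral_finsetSum _ fun i _ => integrable_mul_of_tsupport_subset hΩ huc (hφ2 _) (hc2 _)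
      ((hs2 _).trans hs),
    integral_finsetSum _ fun i _ => integrable_mul_of_tsupport_subset hΩ (hu2 _ _) hφ.continuous
      hc hs]
  exact Finset.sum_congr rfl fun i _ => key _

lemma hasFDerivAt_norm_sub_sq {n : ℕ} (a x : Euc n) :
    HasFDerivAt (fun y => ‖y - a‖ ^ 2) (2 • innerSL ℝ (x - a)) x := by
  have h := ((hasFDerivAt_id (𝕜 := ℝ) x).sub_const a).norm_sq
  simpa using h

/-- The Laplacian of a function of `‖y - a‖ ^ 2`. -/
lemma lap_radial {n : ℕ} (a : Euc n) {G G₁ G₂ : ℝ → ℝ}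
    (h₁ : ∀ s, 0 ≤ s → HasDerivAt G (G₁ s) s) (h₂ : ∀ s, 0 ≤ s → HasDerivAt G₁ (G₂ s) s)
    (hG : ContDiff ℝ 2 fun y : Euc n => G (‖y - a‖ ^ 2)) (x : Euc n) :
    lap (fun y : Euc n => G (‖y - a‖ ^ 2)) x =
      4 * ‖x - a‖ ^ 2 * G₂ (‖x - a‖ ^ 2) + 2 * n * G₁ (‖x - a‖ ^ 2) := by
  rw [lap_eq_sum hG.contDiffAt]
  have e1 : ∀ y v : Euc n, fderiv ℝ (fun y : Euc n => G (‖y - a‖ ^ 2)) y v =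
      G₁ (‖y - a‖ ^ 2) * (2 * inner ℝ (y - a) v) := by
    intro y v
    have h := (h₁ (‖y - a‖ ^ 2) (by positivity)).comp_hasFDerivAt y (hasFDerivAt_norm_sub_sq a y)
    have h' := h.fderiv
    simp only [Function.comp_def] at h'
    rw [h']
    simp [inner_sub_left]
  have e2 : ∀ v : Euc n, fderiv ℝ (fun y => fderiv ℝ (fun y : Euc n => G (‖y - a‖ ^ 2)) y v) x v =
      4 * (inner ℝ (x - a) v) ^ 2 * G₂ (‖x - a‖ ^ 2) + 2 * ‖v‖ ^ 2 * G₁ (‖x - a‖ ^ 2) := by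
    intro v
    simp only [e1]
    have h := (h₂ (‖x - a‖ ^ 2) (by positivity)).comp_hasFDerivAt x (hasFDerivAt_norm_sub_sq a x)
    have hi : HasFDerivAt (fun y : Euc n => 2 * inner ℝ (y - a) v)
        ((2 : ℝ) • (innerSL ℝ v)) x := by
      have : HasFDerivAt (fun y : Euc n => innerSL ℝ v (y - a)) (innerSL ℝ v) x := by
        simpa [Function.comp_def] using
          (innerSL ℝ v).hasFDerivAt.comp x ((hasFDerivAt_id (𝕜 := ℝ) x).sub_const a)
      simpa [real_inner_comm] using this.const_mul 2
    have h' := (h.mul hi).fderiv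
    simp only [Function.comp_def] at h'
    have : (fun y : Euc n => G₁ (‖y - a‖ ^ 2) * (2 * inner ℝ (y - a) v)) =
      ((fun x ↦ G₁ (‖x - a‖ ^ 2)) * fun y ↦ 2 * inner ℝ (y - a) v) := rfl
    rw [this, h']
    simp [inner_sub_left]
    ring
  simp only [e2]
  rw [Finset.sum_add_distrib, ← Finset.sum_mul, ← Finset.mul_sum]
  have e3 : ∑ i : Fin n, (inner ℝ (x - a) (EuclideanSpace.single i (1 : ℝ))) ^ 2 =
      ‖x - a‖ ^ 2 := by
    rw [EuclideanSpace.norm_sq_eq]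
    simp [EuclideanSpace.inner_single_right]
  rw [e3]
  simp
  ring

lemma lintegral_unit_ball_rpow_neg_ne_top {n : ℕ} (hn : 1 ≤ n) {β : ℝ} (hβ : β < n) :
    ∫⁻ y in ball (0 : Euc n) 1, ‖y‖ₑ ^ (-β) ≠ ⊤ := by
  have : Nonempty (Fin n) := ⟨⟨0, hn⟩⟩
  have h : IntegrableOn (fun y : Euc n => ‖y‖ ^ (-β)) (ball 0 1) := by
    refine integrableOn_ball_of_norm_le_rpow (C := 1) (α := β) (by simpa using hn)
      (by simpa using hβ) (Eventually.of_forall fun x => ?_)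
      (measurable_norm.pow_const _).aestronglyMeasurable
    rw [Real.norm_of_nonneg (by positivity), one_mul]
  have h2 := h.2
  rw [hasFiniteIntegral_iff_enorm] at h2
  refine ne_of_lt (lt_of_le_of_lt (lintegral_mono_ae ?_) h2)
  have h0 : ∀ᵐ y : Euc n, y ≠ 0 := by
    simp [ae_iff]
  filter_upwards [ae_restrict_of_ae h0] with y hy
  rw [← ofReal_norm, ENNReal.ofReal_rpow_of_pos (norm_pos_iff.2 hy),
    ← ofReal_norm, Real.norm_of_nonneg (by positivity)]

lemma lintegral_ball_rpow_neg_eq {n : ℕ} (z : Euc n) {β ρ : ℝ} (hρ : 0 < ρ) :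
    ∫⁻ y in ball z ρ, ‖y - z‖ₑ ^ (-β) =
      ENNReal.ofReal (ρ ^ ((n : ℝ) - β)) * ∫⁻ y in ball (0 : Euc n) 1, ‖y‖ₑ ^ (-β) := by
  have hm : Measurable fun y : Euc n => ‖y‖ₑ ^ (-β) := measurable_enorm.pow_const _
  have e1 : ∫⁻ y in ball z ρ, ‖y - z‖ₑ ^ (-β) = ∫⁻ y in ball (0 : Euc n) ρ, ‖y‖ₑ ^ (-β) := by
    have h := (measurePreserving_sub_right (volume : Measure (Euc n)) z).setLIntegral_comp_preimage
      (measurableSet_ball (x := (0 : Euc n)) (ε := ρ)) hm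
    rw [← h]
    congr 2
    ext y
    simp [dist_eq_norm]
  have e2 : ∫⁻ y in ball (0 : Euc n) 1, ‖ρ • y‖ₑ ^ (-β) =
      ENNReal.ofReal |(ρ ^ n)⁻¹| * ∫⁻ y in ball (0 : Euc n) ρ, ‖y‖ₑ ^ (-β) := by
    have hmap := Measure.map_addHaar_smul (volume : Measure (Euc n)) hρ.ne'
    have h := setLIntegral_map (μ := (volume : Measure (Euc n))) (g := fun y : Euc n => ρ • y)
      (measurableSet_ball (x := (0 : Euc n)) (ε := ρ)) hm (measurable_const_smul ρ)
    rw [hmap] at h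
    have hb : (fun y : Euc n => ρ • y) ⁻¹' ball 0 ρ = ball 0 1 := by
      ext y
      simp [norm_smul, abs_of_pos hρ, hρ]
    rw [hb] at h
    rw [← h]
    simp
  have e3 : ∫⁻ y in ball (0 : Euc n) 1, ‖ρ • y‖ₑ ^ (-β) =
      ENNReal.ofReal (ρ ^ (-β)) * ∫⁻ y in ball (0 : Euc n) 1, ‖y‖ₑ ^ (-β) := by
    rw [← lintegral_const_mul _ hm]
    refine lintegral_congr fun y => ?_
    rw [enorm_smul, ENNReal.mul_rpow_of_ne_top (by simp) (by simp),
      ← ofReal_norm ρ, Real.norm_of_nonneg hρ.le, ENNReal.ofReal_rpow_of_pos hρ]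
  rw [e3, abs_of_pos (by positivity)] at e2
  rw [e1, sub_eq_add_neg, Real.rpow_add hρ, Real.rpow_natCast,
    ENNReal.ofReal_mul (by positivity), mul_assoc, e2, ← mul_assoc, ← ENNReal.ofReal_mul
    (by positivity), mul_inv_cancel₀ (by positivity), ENNReal.ofReal_one, one_mul]

lemma exists_lintegral_ball_rpow_neg_le {n : ℕ} (hn : 1 ≤ n) {β : ℝ} (hβ0 : 0 ≤ β) (hβ : β < n) :
    ∃ C : ENNReal, C ≠ ⊤ ∧ ∀ (a z : Euc n) (ρ : ℝ), 0 < ρ →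
      ∫⁻ y in ball a ρ, ‖y - z‖ₑ ^ (-β) ≤ C * ENNReal.ofReal (ρ ^ ((n : ℝ) - β)) := by
  have : Nonempty (Fin n) := ⟨⟨0, hn⟩⟩
  refine ⟨(∫⁻ y in ball (0 : Euc n) 1, ‖y‖ₑ ^ (-β)) + volume (ball (0 : Euc n) 1),
    ENNReal.add_ne_top.2 ⟨lintegral_unit_ball_rpow_neg_ne_top hn hβ, measure_ball_lt_top.ne⟩,
    fun a z ρ hρ => ?_⟩
  have hsub : ball a ρ ⊆ ball z ρ ∪ (ball a ρ \ ball z ρ) := by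
    intro y hy
    by_cases h : y ∈ ball z ρ
    · exact Or.inl h
    · exact Or.inr ⟨hy, h⟩
  refine (lintegral_mono_set hsub).trans ((lintegral_union_le _ _ _).trans ?_)
  rw [add_mul]
  refine add_le_add ?_ ?_
  · rw [lintegral_ball_rpow_neg_eq z hρ, mul_comm]
  · have hb : ∀ y ∈ ball a ρ \ ball z ρ, ‖y - z‖ₑ ^ (-β) ≤ ENNReal.ofReal (ρ ^ (-β)) := by
      intro y hy
      have hy' : ρ ≤ ‖y - z‖ := by simpa [dist_eq_norm] using hy.2
      rw [← ofReal_norm, ENNReal.ofReal_rpow_of_pos (hρ.trans_le hy')]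
      exact ENNReal.ofReal_le_ofReal (Real.rpow_le_rpow_of_nonpos hρ hy' (by linarith))
    refine (setLIntegral_mono' (measurableSet_ball.diff measurableSet_ball) hb).trans ?_
    rw [setLIntegral_const]
    refine (mul_le_mul_right (measure_mono sdiff_subset) _).trans ?_
    rw [Measure.addHaar_ball _ _ hρ.le, finrank_euclideanSpace_fin, ← mul_assoc,
      ← ENNReal.ofReal_mul (by positivity), mul_comm (volume _), sub_eq_neg_add,
      Real.rpow_add hρ, Real.rpow_natCast]

lemma measurable_rpow_sub {n : ℕ} (β : ℝ) :
    Measurable fun q : Euc n × Euc n => ‖q.1 - q.2‖ₑ ^ (-β) :=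
  (measurable_fst.sub measurable_snd).enorm.pow_const _

lemma exists_lintegral_ball_potential_le {n : ℕ} (hn : 1 ≤ n) {γ : ℝ} (hγ0 : 0 ≤ γ) (hγ : γ < n)
    (μ : Measure (Euc n)) [IsFiniteMeasure μ] :
    ∃ C : ENNReal, C ≠ ⊤ ∧ ∀ (a : Euc n) (ρ : ℝ), 0 < ρ →
      ∫⁻ y in ball a ρ, ∫⁻ z, ‖y - z‖ₑ ^ (-γ) ∂μ ≤ C * ENNReal.ofReal (ρ ^ ((n : ℝ) - γ)) := by
  obtain ⟨C, hC, h⟩ := exists_lintegral_ball_rpow_neg_le hn hγ0 hγ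
  refine ⟨C * μ univ, ENNReal.mul_ne_top hC (measure_ne_top _ _), fun a ρ hρ => ?_⟩
  rw [lintegral_lintegral_swap (measurable_rpow_sub γ).aemeasurable]
  refine (lintegral_mono fun z => h a z ρ hρ).trans ?_
  rw [lintegral_const]
  exact le_of_eq (by ring)

lemma rpow_neg_mul_rpow_neg_le {a b : ENNReal} {s t : ℝ} (hs : 0 ≤ s) (ht : 0 ≤ t) :
    a ^ (-s) * b ^ (-t) ≤ a ^ (-(s + t)) + b ^ (-(s + t)) := by
  have hadd : ∀ c : ENNReal, c ^ (-s) * c ^ (-t) = c ^ (-(s + t)) := by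
    intro c
    rw [ENNReal.rpow_neg, ENNReal.rpow_neg, ENNReal.rpow_neg,
      ENNReal.rpow_add_of_nonneg _ _ hs ht]
    by_cases hs0 : s = 0
    · simp [hs0]
    by_cases ht0 : t = 0
    · simp [ht0]
    have hs' := lt_of_le_of_ne hs (Ne.symm hs0)
    have ht' := lt_of_le_of_ne ht (Ne.symm ht0)
    rcases eq_or_ne c 0 with rfl | hc
    · simp [hs', ht']
    · rcases eq_or_ne c ⊤ with rfl | hc'
      · simp [hs', ht']
      · rw [ENNReal.mul_inv] <;> simp [hc, hc']
  have hanti : ∀ {c d : ENNReal} {r : ℝ}, 0 ≤ r → c ≤ d → d ^ (-r) ≤ c ^ (-r) := by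
    intro c d r hr hcd
    rw [ENNReal.rpow_neg, ENNReal.rpow_neg]
    exact ENNReal.inv_le_inv.2 (ENNReal.rpow_le_rpow hcd hr)
  rcases le_total a b with h | h
  · refine le_trans ?_ le_self_add
    rw [← hadd a]
    exact mul_le_mul_right (hanti ht h) _
  · refine le_trans ?_ le_add_self
    rw [← hadd b]
    exact mul_le_mul_left (hanti hs h) _

lemma lintegral_rpow_le_of_isFiniteMeasure {α : Type*} [MeasurableSpace α] (μ : Measure α)
    [IsFiniteMeasure μ] {p : ℝ} (hp : 1 ≤ p) {f : α → ENNReal} (hf : AEMeasurable f μ) :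
    (∫⁻ z, f z ∂μ) ^ p ≤ μ univ ^ (p - 1) * ∫⁻ z, f z ^ p ∂μ := by
  rcases hp.eq_or_lt with rfl | hp1
  · simp
  have hpq := Real.HolderConjugate.conjExponent hp1
  have h := ENNReal.lintegral_mul_le_Lp_mul_Lq μ hpq hf (aemeasurable_const (b := (1 : ENNReal)))
  have h' := ENNReal.rpow_le_rpow h (zero_le_one.trans hp)
  have hp0 : 0 < p := by linarith
  simp only [Pi.mul_apply, mul_one, ENNReal.one_rpow, lintegral_const, one_mul] at h'
  rw [ENNReal.mul_rpow_of_nonneg _ _ hp0.le, ← ENNReal.rpow_mul, ← ENNReal.rpow_mul,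
    one_div_mul_cancel hp0.ne', ENNReal.rpow_one, mul_comm] at h'
  convert h' using 3
  rw [Real.conjExponent]
  field_simp

lemma exists_lintegral_mul_potential_rpow_le {n : ℕ} (hn : 1 ≤ n) {γ s p : ℝ} (hγ0 : 0 ≤ γ)
    (hs : 0 ≤ s) (hp : 1 ≤ p) (h : s + p * γ < n) (μ : Measure (Euc n)) [IsFiniteMeasure μ] :
    ∃ C : ENNReal, C ≠ ⊤ ∧ ∀ x : Euc n,
      ∫⁻ y in ball (0 : Euc n) 1, ‖x - y‖ₑ ^ (-s) * (∫⁻ z, ‖y - z‖ₑ ^ (-γ) ∂μ) ^ p ≤ C := by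
  have hp0 : 0 ≤ p := by linarith
  obtain ⟨C, hC, hball⟩ := exists_lintegral_ball_rpow_neg_le hn
    (add_nonneg hs (mul_nonneg hp0 hγ0)) h
  have hμ : μ univ ≠ ⊤ := measure_ne_top _ _
  refine ⟨μ univ ^ (p - 1) * ((C + C) * μ univ), ENNReal.mul_ne_top
    (ENNReal.rpow_ne_top_of_nonneg (by linarith) hμ)
    (ENNReal.mul_ne_top (ENNReal.add_ne_top.2 ⟨hC, hC⟩) hμ), fun x => ?_⟩
  have hmk : ∀ y : Euc n, Measurable fun z : Euc n => ‖y - z‖ₑ ^ (-γ) := fun y =>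
    (measurable_const.sub measurable_id).enorm.pow_const _
  calc ∫⁻ y in ball (0 : Euc n) 1, ‖x - y‖ₑ ^ (-s) * (∫⁻ z, ‖y - z‖ₑ ^ (-γ) ∂μ) ^ p
      ≤ ∫⁻ y in ball (0 : Euc n) 1, μ univ ^ (p - 1) *
          ∫⁻ z, (‖y - x‖ₑ ^ (-(s + p * γ)) + ‖y - z‖ₑ ^ (-(s + p * γ))) ∂μ := by
        refine lintegral_mono fun y => ?_
        refine (mul_le_mul_right
          (lintegral_rpow_le_of_isFiniteMeasure μ hp (hmk y).aemeasurable) _).trans ?_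
        rw [mul_left_comm, ← lintegral_const_mul _ ((hmk y).pow_const p)]
        refine mul_le_mul_right (lintegral_mono fun z => ?_) _
        rw [← ENNReal.rpow_mul, show -γ * p = -(p * γ) by ring, enorm_sub_rev x y]
        exact rpow_neg_mul_rpow_neg_le hs (mul_nonneg hp0 hγ0)
    _ = μ univ ^ (p - 1) * ∫⁻ z, ∫⁻ y in ball (0 : Euc n) 1,
          (‖y - x‖ₑ ^ (-(s + p * γ)) + ‖y - z‖ₑ ^ (-(s + p * γ))) ∂volume ∂μ := by
        have hm : Measurable fun q : Euc n × Euc n =>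
            ‖q.1 - x‖ₑ ^ (-(s + p * γ)) + ‖q.1 - q.2‖ₑ ^ (-(s + p * γ)) :=
          ((measurable_fst.sub measurable_const).enorm.pow_const _).add (measurable_rpow_sub _)
        rw [lintegral_const_mul _ hm.lintegral_prod_right', lintegral_lintegral_swap]
        exact hm.aemeasurable
    _ ≤ μ univ ^ (p - 1) * ∫⁻ _ : Euc n, (C + C) ∂μ := by
        refine mul_le_mul_right (lintegral_mono fun z => ?_) _
        have hm : Measurable fun y : Euc n => ‖y - x‖ₑ ^ (-(s + p * γ)) :=
          (measurable_id.sub measurable_const).enorm.pow_const _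
        rw [lintegral_add_left hm]
        have h1 := hball 0 x 1 one_pos
        have h2 := hball 0 z 1 one_pos
        simp only [Real.one_rpow, ENNReal.ofReal_one, mul_one] at h1 h2
        exact add_le_add h1 h2
    _ = _ := by rw [lintegral_const]

lemma exists_smooth_cutoff : ∃ χ χ₁ χ₂ : ℝ → ℝ, ∃ C : ℝ, 0 < C ∧ ContDiff ℝ 2 χ ∧
    (∀ s, HasDerivAt χ (χ₁ s) s) ∧ (∀ s, HasDerivAt χ₁ (χ₂ s) s) ∧
    (∀ s, 0 ≤ χ s) ∧ (∀ s, χ s ≤ 1) ∧ (∀ s ≤ 1 / 4, χ s = 1) ∧ (∀ s, 1 ≤ s → χ s = 0) ∧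
    (∀ s, |χ₁ s| ≤ C) ∧ (∀ s, |χ₂ s| ≤ C) ∧
    (∀ s, s < 1 / 4 ∨ 1 < s → χ₁ s = 0 ∧ χ₂ s = 0) := by
  let χ : ℝ → ℝ := fun s => Real.smoothTransition ((1 - s) * (4 / 3))
  have hχ : ContDiff ℝ 2 χ := Real.smoothTransition.contDiff.comp (by fun_prop)
  have hχ1 : ContDiff ℝ 1 (deriv χ) := by
    have h : ContDiff ℝ (1 + 1) χ := by norm_num; exact hχ
    exact (contDiff_succ_iff_deriv.1 h).2.2
  have hone : ∀ s ≤ 1 / 4, χ s = 1 := fun s hs =>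
    Real.smoothTransition.one_of_one_le (by linarith)
  have hzero : ∀ s, 1 ≤ s → χ s = 0 := fun s hs =>
    Real.smoothTransition.zero_of_nonpos (by linarith)
  have hd : ∀ s, s < 1 / 4 ∨ 1 < s → deriv χ s = 0 ∧ deriv (deriv χ) s = 0 := by
    rintro s (hs | hs)
    · have h : χ =ᶠ[𝓝 s] fun _ => 1 := by
        filter_upwards [Iio_mem_nhds hs] with t ht using hone t ht.le
      refine ⟨by rw [h.deriv_eq, deriv_const], ?_⟩
      rw [h.deriv.deriv_eq]
      simp
    · have h : χ =ᶠ[𝓝 s] fun _ => 0 := by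
        filter_upwards [Ioi_mem_nhds hs] with t ht using hzero t ht.le
      refine ⟨by rw [h.deriv_eq, deriv_const], ?_⟩
      rw [h.deriv.deriv_eq]
      simp
  obtain ⟨C₁, hC₁⟩ := (isCompact_Icc (a := (1 / 4 : ℝ)) (b := 1)).exists_bound_of_continuousOn
    hχ1.continuous.continuousOn
  obtain ⟨C₂, hC₂⟩ := (isCompact_Icc (a := (1 / 4 : ℝ)) (b := 1)).exists_bound_of_continuousOn
    (hχ1.continuous_deriv le_rfl).continuousOn
  have hC : 0 < max (max C₁ C₂) 1 := lt_max_of_lt_right one_pos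
  refine ⟨χ, deriv χ, deriv (deriv χ), max (max C₁ C₂) 1, hC, hχ,
    fun s => (hχ.differentiable (by norm_num) s).hasDerivAt,
    fun s => (hχ1.differentiable (by norm_num) s).hasDerivAt,
    fun s => Real.smoothTransition.nonneg _, fun s => Real.smoothTransition.le_one _,
    hone, hzero, fun s => ?_, fun s => ?_, hd⟩
  · by_cases hs : s < 1 / 4 ∨ 1 < s
    · simp [(hd s hs).1]
    · push Not at hs
      exact (hC₁ s hs).trans ((le_max_left _ _).trans (le_max_left _ _))
  · by_cases hs : s < 1 / 4 ∨ 1 < s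
    · simp [(hd s hs).2]
    · push Not at hs
      exact (hC₂ s hs).trans ((le_max_right _ _).trans (le_max_left _ _))

lemma hasDerivAt_max_zero_pow (k : ℕ) (x : ℝ) :
    HasDerivAt (fun x : ℝ => max x 0 ^ (k + 2)) ((k + 2) * max x 0 ^ (k + 1)) x := by
  rcases lt_trichotomy x 0 with hx | rfl | hx
  · have h : (fun x : ℝ => max x 0 ^ (k + 2)) =ᶠ[𝓝 x] fun _ => 0 := by
      filter_upwards [Iio_mem_nhds hx] with t ht
      simp [max_eq_right (mem_Iio.1 ht).le]
    simpa [max_eq_right hx.le] using (hasDerivAt_const x (0 : ℝ)).congr_of_eventuallyEq h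
  · rw [hasDerivAt_iff_isLittleO_nhds_zero]
    simp only [zero_add, max_self, ne_eq, Nat.add_eq_zero_iff, one_ne_zero, and_false,
      not_false_eq_true, zero_pow, mul_zero, OfNat.ofNat_ne_zero, sub_zero, smul_zero]
    have h1 : (fun h : ℝ => h ^ (k + 2)) =o[𝓝 0] fun h => h ^ 1 :=
      isLittleO_pow_pow (by omega)
    simp only [pow_one] at h1
    refine IsBigO.trans_isLittleO (IsBigO.of_bound 1 (Eventually.of_forall fun h => ?_)) h1
    rw [one_mul, norm_pow, norm_pow]
    refine pow_le_pow_left₀ (norm_nonneg _) ?_ _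
    rw [Real.norm_of_nonneg (le_max_right _ _), Real.norm_eq_abs]
    exact max_le (le_abs_self h) (abs_nonneg h)
  · have h : (fun x : ℝ => max x 0 ^ (k + 2)) =ᶠ[𝓝 x] fun x => x ^ (k + 2) := by
      filter_upwards [Ioi_mem_nhds hx] with t ht
      simp [max_eq_left (mem_Ioi.1 ht).le]
    have := (hasDerivAt_pow (k + 2) x).congr_of_eventuallyEq h
    simpa [max_eq_left hx.le] using this

lemma contDiff_max_zero_cube : ContDiff ℝ 2 fun x : ℝ => max x 0 ^ 3 := by
  have d3 : deriv (fun x : ℝ => max x 0 ^ 3) = fun x => 3 * max x 0 ^ 2 := by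
    ext x
    have := (hasDerivAt_max_zero_pow 1 x).deriv
    norm_num at this ⊢
    exact this
  have d2 : deriv (fun x : ℝ => max x 0 ^ 2) = fun x => 2 * max x 0 := by
    ext x
    have := (hasDerivAt_max_zero_pow 0 x).deriv
    norm_num at this ⊢
    exact this
  have c1 : ContDiff ℝ 1 fun x : ℝ => max x 0 ^ 2 := by
    refine contDiff_one_iff_deriv.2 ⟨fun x => (hasDerivAt_max_zero_pow 0 x).differentiableAt, ?_⟩
    rw [d2]
    fun_prop
  have : ContDiff ℝ (1 + 1) fun x : ℝ => max x 0 ^ 3 := by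
    refine contDiff_succ_iff_deriv.2
      ⟨fun x => (hasDerivAt_max_zero_pow 1 x).differentiableAt, by simp, ?_⟩
    rw [d3]
    exact contDiff_const.mul c1
  norm_num at this
  exact this

lemma hasDerivAt_add_rpow_neg {b s : ℝ} (hb : 0 < b) (hs : 0 ≤ s) (m : ℝ) :
    HasDerivAt (fun s => (s + b) ^ (-m)) (-m * (s + b) ^ (-(m + 1))) s := by
  have h := ((hasDerivAt_id s).add_const b).rpow_const (p := -m) (Or.inl (by simp; positivity))
  simp only [id, one_mul] at h
  rwa [show -m - 1 = -(m + 1) by ring] at h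

lemma contDiff_add_rpow_neg {n : ℕ} (a : Euc n) {b : ℝ} (hb : 0 < b) (m : ℝ) :
    ContDiff ℝ 2 fun y : Euc n => (‖y - a‖ ^ 2 + b) ^ (-m) := by
  refine ContDiff.rpow_const_of_ne ?_ fun y => by positivity
  exact ((contDiff_id.sub contDiff_const).norm_sq ℝ).add contDiff_const

/-- Test function for the local bound: a regularized fundamental solution cut off at radius `r`. -/
lemma exists_test_function_ball {n : ℕ} (hn : 3 ≤ n) : ∃ C c : ℝ, 0 < C ∧ 0 < c ∧
    ∀ (a : Euc n) (r ε : ℝ), 0 < ε → ε ≤ r / 2 → ∃ φ : Euc n → ℝ, ContDiff ℝ 2 φ ∧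
      tsupport φ ⊆ closedBall a r ∧ (∀ y, 0 ≤ φ y) ∧
      (∀ y, y ≠ a → φ y ≤ ‖y - a‖ ^ (-((n : ℝ) - 2))) ∧
      (∀ y ∈ ball a ε, lap φ y ≤ -c * ε ^ (-(n : ℝ))) ∧
      (∀ y, lap φ y ≤ C * r ^ (-(n : ℝ))) ∧
      (∀ y ∉ closedBall a r, lap φ y = 0) := by
  obtain ⟨χ, χ₁, χ₂, D, hD, hχ, hd1, hd2, h0, h1, hone, hzero, hb1, hb2, hout⟩ :=
    exists_smooth_cutoff
  have hn3 : (3 : ℝ) ≤ n := by exact_mod_cast hn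
  set m : ℝ := ((n : ℝ) - 2) / 2 with hm
  have hm0 : 0 < m := by rw [hm]; linarith
  have hnm : (n : ℝ) = 2 * m + 2 := by rw [hm]; ring
  refine ⟨8 * D * m * 4 ^ (m + 1) + D * (4 + 2 * n) * 4 ^ m, 4 * m * (m + 1) * 2 ^ (-(m + 2)),
    by positivity, by positivity, fun a r ε hε hεr => ?_⟩
  have hr : 0 < r := by linarith
  have hr2 : 0 < r ^ 2 := by positivity
  set b : ℝ := ε ^ 2 with hb
  have hb0 : 0 < b := by positivity
  have hbr : b ≤ r ^ 2 / 4 := by rw [hb]; nlinarith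
  have hsb : ∀ s : ℝ, 0 ≤ s → 0 < s + b := fun s hs => by linarith
  have hrn : r ^ (-(n : ℝ)) = (r ^ 2) ^ (-(m + 1)) := by
    rw [← Real.rpow_natCast r 2, ← Real.rpow_mul hr.le]
    congr 1
    rw [hnm]; push_cast; ring
  have hεn : ε ^ (-(n : ℝ)) = b ^ (-(m + 1)) := by
    rw [hb, ← Real.rpow_natCast ε 2, ← Real.rpow_mul hε.le]
    congr 1
    rw [hnm]; push_cast; ring
  let G : ℝ → ℝ := fun s => χ (s / r ^ 2) * (s + b) ^ (-m)
  let G₁ : ℝ → ℝ := fun s => χ₁ (s / r ^ 2) / r ^ 2 * (s + b) ^ (-m) +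
    χ (s / r ^ 2) * (-m * (s + b) ^ (-(m + 1)))
  let G₂ : ℝ → ℝ := fun s => (χ₂ (s / r ^ 2) / r ^ 2 / r ^ 2 * (s + b) ^ (-m) +
    χ₁ (s / r ^ 2) / r ^ 2 * (-m * (s + b) ^ (-(m + 1)))) +
    (χ₁ (s / r ^ 2) / r ^ 2 * (-m * (s + b) ^ (-(m + 1))) +
    χ (s / r ^ 2) * (-m * (-(m + 1) * (s + b) ^ (-(m + 1 + 1)))))
  have hdiv : ∀ s, HasDerivAt (fun s : ℝ => s / r ^ 2) (1 / r ^ 2) s := fun s =>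
    (hasDerivAt_id s).div_const _
  have hdχ : ∀ s, HasDerivAt (fun s => χ (s / r ^ 2)) (χ₁ (s / r ^ 2) / r ^ 2) s := fun s => by
    have := (hd1 (s / r ^ 2)).comp s (hdiv s)
    rwa [mul_one_div] at this
  have hdχ1 : ∀ s, HasDerivAt (fun s => χ₁ (s / r ^ 2) / r ^ 2)
      (χ₂ (s / r ^ 2) / r ^ 2 / r ^ 2) s := fun s => by
    have := ((hd2 (s / r ^ 2)).comp s (hdiv s)).div_const (r ^ 2)
    rwa [mul_one_div] at this
  have hG1 : ∀ s, 0 ≤ s → HasDerivAt G (G₁ s) s := fun s hs =>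
    (hdχ s).mul (hasDerivAt_add_rpow_neg hb0 hs m)
  have hG2 : ∀ s, 0 ≤ s → HasDerivAt G₁ (G₂ s) s := fun s hs =>
    ((hdχ1 s).mul (hasDerivAt_add_rpow_neg hb0 hs m)).add
      ((hdχ s).mul ((hasDerivAt_add_rpow_neg hb0 hs (m + 1)).const_mul (-m)))
  have hcd : ContDiff ℝ 2 fun y : Euc n => G (‖y - a‖ ^ 2) := by
    refine ContDiff.mul (hχ.comp ?_) (contDiff_add_rpow_neg a hb0 m)
    exact ((contDiff_id.sub contDiff_const).norm_sq ℝ).div_const _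
  have hlap : ∀ y : Euc n, ∀ s, s = ‖y - a‖ ^ 2 → lap (fun y : Euc n => G (‖y - a‖ ^ 2)) y =
      -(χ (s / r ^ 2) * (4 * m * (m + 1) * b * (s + b) ^ (-(m + 2)))) +
      (-(8 * (s / r ^ 2) * χ₁ (s / r ^ 2) * (m * (s + b) ^ (-(m + 1)))) +
        (4 * (s / r ^ 2) * χ₂ (s / r ^ 2) + 2 * n * χ₁ (s / r ^ 2)) / r ^ 2 *
          (s + b) ^ (-m)) := by
    intro y s hs
    have hs0 : 0 ≤ s := by rw [hs]; positivity
    rw [lap_radial a hG1 hG2 hcd y, ← hs]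
    have e : (s + b) ^ (-(m + 1)) = (s + b) ^ (-(m + 2)) * (s + b) := by
      rw [← Real.rpow_add_one (hsb s hs0).ne']
      congr 1; ring
    simp only [G₁, G₂]
    rw [show -(m + 1 + 1) = -(m + 2) by ring, e, hnm]
    field_simp
    ring
  have hmem : ∀ y, y ∈ closedBall a r ↔ ‖y - a‖ ^ 2 / r ^ 2 ≤ 1 := by
    intro y
    rw [mem_closedBall, dist_eq_norm, div_le_one hr2]
    exact (pow_le_pow_iff_left₀ (norm_nonneg _) hr.le (by norm_num)).symm
  refine ⟨_, hcd, ?_, ?_, ?_, ?_, ?_, ?_⟩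
  · refine closure_minimal (fun y hy => ?_) isClosed_closedBall
    by_contra hc
    rw [hmem, not_le] at hc
    exact hy (by simp only [G]; rw [hzero _ hc.le, zero_mul])
  · intro y
    exact mul_nonneg (h0 _) (Real.rpow_nonneg (by positivity) _)
  · intro y hy
    have hpos : 0 < ‖y - a‖ := norm_pos_iff.2 (sub_ne_zero.2 hy)
    calc G (‖y - a‖ ^ 2) ≤ 1 * (‖y - a‖ ^ 2 + b) ^ (-m) :=
          mul_le_mul_of_nonneg_right (h1 _) (Real.rpow_nonneg (by positivity) _)
      _ ≤ (‖y - a‖ ^ 2) ^ (-m) := by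
          rw [one_mul]
          exact Real.rpow_le_rpow_of_nonpos (by positivity) (by linarith) (by linarith)
      _ = ‖y - a‖ ^ (-((n : ℝ) - 2)) := by
          rw [← Real.rpow_natCast _ 2, ← Real.rpow_mul hpos.le]
          congr 1
          rw [hm]; push_cast; ring
  · intro y hy
    have hs : ‖y - a‖ ^ 2 < b := by
      rw [hb]
      exact pow_lt_pow_left₀ (by simpa [dist_eq_norm] using hy) (norm_nonneg _) (by norm_num)
    have hs4 : ‖y - a‖ ^ 2 / r ^ 2 < 1 / 4 := by
      rw [div_lt_iff₀ hr2]; linarith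
    rw [hlap y _ rfl, hone _ hs4.le, (hout _ (Or.inl hs4)).1, (hout _ (Or.inl hs4)).2, hεn]
    have e1 : (b + b) ^ (-(m + 2)) ≤ (‖y - a‖ ^ 2 + b) ^ (-(m + 2)) :=
      Real.rpow_le_rpow_of_nonpos (by positivity) (by linarith) (by linarith)
    have e2 : (b + b) ^ (-(m + 2)) = 2 ^ (-(m + 2)) * b ^ (-(m + 2)) := by
      rw [← two_mul, Real.mul_rpow (by norm_num) hb0.le]
    have e3 : b ^ (-(m + 1)) = b * b ^ (-(m + 2)) := by
      rw [mul_comm, ← Real.rpow_add_one hb0.ne']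
      congr 1; ring
    rw [e2] at e1
    have e4 : 0 ≤ 4 * m * (m + 1) * b := by positivity
    have := mul_le_mul_of_nonneg_left e1 e4
    rw [e3]
    simp only [mul_zero, zero_mul, add_zero, zero_div, neg_zero, one_mul]
    linarith
  · intro y
    rw [hlap y _ rfl, hrn]
    set s := ‖y - a‖ ^ 2 with hs
    have hs0 : 0 ≤ s := by positivity
    have hpos : 0 ≤ χ (s / r ^ 2) * (4 * m * (m + 1) * b * (s + b) ^ (-(m + 2))) :=
      mul_nonneg (h0 _) (mul_nonneg (by positivity) (Real.rpow_nonneg (hsb s hs0).le _))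
    by_cases ht : s / r ^ 2 < 1 / 4 ∨ 1 < s / r ^ 2
    · rw [(hout _ ht).1, (hout _ ht).2]
      simp only [mul_zero, zero_mul, add_zero, zero_div, neg_zero]
      have : 0 ≤ (8 * D * m * 4 ^ (m + 1) + D * (4 + 2 * n) * 4 ^ m) * (r ^ 2) ^ (-(m + 1)) := by
        positivity
      linarith
    · push Not at ht
      have hs4 : r ^ 2 / 4 ≤ s + b := by
        have := (le_div_iff₀ hr2).1 ht.1
        linarith
      have k1 : (s + b) ^ (-(m + 1)) ≤ 4 ^ (m + 1) * (r ^ 2) ^ (-(m + 1)) := by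
        refine (Real.rpow_le_rpow_of_nonpos (by positivity) hs4 (by linarith)).trans_eq ?_
        rw [Real.div_rpow hr2.le (by norm_num), Real.rpow_neg (by norm_num : (0 : ℝ) ≤ 4),
          div_inv_eq_mul,
          mul_comm]
      have k0 : (s + b) ^ (-m) ≤ 4 ^ m * ((r ^ 2) ^ (-(m + 1)) * r ^ 2) := by
        refine (Real.rpow_le_rpow_of_nonpos (by positivity) hs4 (by linarith)).trans_eq ?_
        rw [Real.div_rpow hr2.le (by norm_num), Real.rpow_neg (by norm_num : (0 : ℝ) ≤ 4),
          div_inv_eq_mul,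
          mul_comm, ← Real.rpow_add_one hr2.ne']
        congr 2; ring
      have t1 : -(8 * (s / r ^ 2) * χ₁ (s / r ^ 2) * (m * (s + b) ^ (-(m + 1)))) ≤
          8 * D * m * 4 ^ (m + 1) * (r ^ 2) ^ (-(m + 1)) := by
        have hx := neg_le_of_abs_le (hb1 (s / r ^ 2))
        have ht0 : 0 ≤ s / r ^ 2 := by positivity
        have : -(8 * (s / r ^ 2) * χ₁ (s / r ^ 2)) ≤ 8 * D := by nlinarith [ht.2]
        calc _ = -(8 * (s / r ^ 2) * χ₁ (s / r ^ 2)) * (m * (s + b) ^ (-(m + 1))) := by ring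
          _ ≤ 8 * D * (m * (s + b) ^ (-(m + 1))) :=
            mul_le_mul_of_nonneg_right this
              (mul_nonneg hm0.le (Real.rpow_nonneg (hsb s hs0).le _))
          _ ≤ 8 * D * (m * (4 ^ (m + 1) * (r ^ 2) ^ (-(m + 1)))) := by gcongr
          _ = _ := by ring
      have t2 : (4 * (s / r ^ 2) * χ₂ (s / r ^ 2) + 2 * n * χ₁ (s / r ^ 2)) / r ^ 2 *
          (s + b) ^ (-m) ≤ D * (4 + 2 * n) * 4 ^ m * (r ^ 2) ^ (-(m + 1)) := by
        have hx := le_of_abs_le (hb1 (s / r ^ 2))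
        have hy := le_of_abs_le (hb2 (s / r ^ 2))
        have ht0 : 0 ≤ s / r ^ 2 := by positivity
        have : 4 * (s / r ^ 2) * χ₂ (s / r ^ 2) + 2 * n * χ₁ (s / r ^ 2) ≤ D * (4 + 2 * n) := by
          have a1 : (s / r ^ 2) * χ₂ (s / r ^ 2) ≤ D := by nlinarith [ht.2]
          nlinarith
        calc _ ≤ D * (4 + 2 * n) / r ^ 2 * (s + b) ^ (-m) := by
              refine mul_le_mul_of_nonneg_right ?_ (Real.rpow_nonneg (hsb s hs0).le _)
              gcongr
          _ ≤ D * (4 + 2 * n) / r ^ 2 * (4 ^ m * ((r ^ 2) ^ (-(m + 1)) * r ^ 2)) := by gcongr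
          _ = _ := by field_simp
      linarith
  · intro y hy
    rw [hmem, not_le] at hy
    rw [hlap y _ rfl, hzero _ hy.le, (hout _ (Or.inr hy)).1, (hout _ (Or.inr hy)).2]
    simp

/-- Test function near the puncture: nearly `1` away from `0`, vanishing near `0`, and subharmonic
on the ball of radius `1 / 2`. -/
lemma exists_test_function_puncture {n : ℕ} (hn : 3 ≤ n) : ∃ C c : ℝ, 0 < C ∧ 0 < c ∧
    ∀ ε : ℝ, 0 < ε → ε ≤ 1 → ∃ φ : Euc n → ℝ, ContDiff ℝ 2 φ ∧
      tsupport φ ⊆ closedBall 0 1 \ {0} ∧ (∀ y, 0 ≤ φ y) ∧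
      (∀ y, 4 * ε ≤ ‖y‖ → ‖y‖ ≤ 1 / 2 → 1 / 8 ≤ φ y) ∧
      (∀ y, -C ≤ lap φ y) ∧
      (∀ y, ‖y‖ < 1 / 2 → 0 ≤ lap φ y) ∧
      (∀ y ∉ closedBall 0 1, lap φ y = 0) ∧
      (∀ y, 4 * ε ≤ ‖y‖ → ‖y‖ ≤ 16 * ε → ‖y‖ < 1 / 2 → c / ε ^ 2 ≤ lap φ y) := by
  obtain ⟨χ, χ₁, χ₂, D, hD, hχ, hd1, hd2, h0, h1, hone, hzero, hb1, hb2, hout⟩ :=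
    exists_smooth_cutoff
  have hn3 : (3 : ℝ) ≤ n := by exact_mod_cast hn
  set m : ℝ := ((n : ℝ) - 2) / 2 with hm
  have hm0 : 1 / 2 ≤ m := by rw [hm]; linarith
  have hm0' : 0 < m := by linarith
  have hnm : (n : ℝ) = 2 * m + 2 := by rw [hm]; ring
  refine ⟨24 * D * (2 * m * 4 ^ (m + 1)) + D * (4 + 2 * n),
    24 * 16 * (1 / 2) * (2 * m * 257 ^ (-(m + 1))) ^ 2,
    by positivity, by positivity, fun ε hε hε1 => ?_⟩
  set b : ℝ := ε ^ 2 with hb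
  have hb0 : 0 < b := by positivity
  have hb1' : b ≤ 1 := by rw [hb]; nlinarith
  have hsb : ∀ s : ℝ, 0 ≤ s → 0 < s + b := fun s hs => by linarith
  let P : ℝ → ℝ := fun s => 1 - 2 * b ^ m * (s + b) ^ (-m)
  let P₁ : ℝ → ℝ := fun s => 2 * m * b ^ m * (s + b) ^ (-(m + 1))
  let P₂ : ℝ → ℝ := fun s => 2 * m * b ^ m * (-(m + 1) * (s + b) ^ (-(m + 2)))
  have hP1 : ∀ s, 0 ≤ s → HasDerivAt P (P₁ s) s := fun s hs => by
    have h := ((hasDerivAt_add_rpow_neg hb0 hs m).const_mul (2 * b ^ m)).const_sub 1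
    have e : P₁ s = -(2 * b ^ m * (-m * (s + b) ^ (-(m + 1)))) := by simp only [P₁]; ring
    rw [e]
    exact h
  have hP2 : ∀ s, 0 ≤ s → HasDerivAt P₁ (P₂ s) s := fun s hs => by
    have h := (hasDerivAt_add_rpow_neg hb0 hs (m + 1)).const_mul (2 * m * b ^ m)
    rwa [show -(m + 1 + 1) = -(m + 2) by ring] at h
  have hPsub : ∀ s, 0 ≤ s → 0 ≤ 4 * s * P₂ s + 2 * n * P₁ s := fun s hs => by
    have e : (s + b) ^ (-(m + 1)) = (s + b) ^ (-(m + 2)) * (s + b) := by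
      rw [← Real.rpow_add_one (hsb s hs).ne']
      congr 1; ring
    have : 4 * s * P₂ s + 2 * n * P₁ s =
        8 * m * (m + 1) * b * (b ^ m * (s + b) ^ (-(m + 2))) := by
      simp only [P₁, P₂]
      rw [e, hnm]
      ring
    rw [this]
    have := Real.rpow_nonneg (hsb s hs).le (-(m + 2))
    positivity
  have hP1nn : ∀ s, 0 ≤ s → 0 ≤ P₁ s := fun s hs =>
    mul_nonneg (by positivity) (Real.rpow_nonneg (hsb s hs).le _)
  let Q : ℝ → ℝ := fun s => max (P s) 0
  have hQ0 : ∀ s, 0 ≤ Q s := fun s => le_max_right _ _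
  have hQ1 : ∀ s, 0 ≤ s → Q s ≤ 1 := fun s hs => max_le (by
    have := Real.rpow_nonneg (hsb s hs).le (-m)
    have : 0 ≤ 2 * b ^ m * (s + b) ^ (-m) := by positivity
    simp only [P]; linarith) zero_le_one
  let H : ℝ → ℝ := fun s => Q s ^ 3
  let H₁ : ℝ → ℝ := fun s => 3 * Q s ^ 2 * P₁ s
  let H₂ : ℝ → ℝ := fun s => 3 * (2 * Q s * P₁ s) * P₁ s + 3 * Q s ^ 2 * P₂ s
  have hH1 : ∀ s, 0 ≤ s → HasDerivAt H (H₁ s) s := fun s hs => by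
    have h := (hasDerivAt_max_zero_pow 1 (P s)).comp s (hP1 s hs)
    norm_num at h
    exact h
  have hH2 : ∀ s, 0 ≤ s → HasDerivAt H₁ (H₂ s) s := fun s hs => by
    have h := (hasDerivAt_max_zero_pow 0 (P s)).comp s (hP1 s hs)
    norm_num at h
    exact (h.const_mul 3).mul (hP2 s hs)
  let G : ℝ → ℝ := fun s => χ s * H s
  let G₁ : ℝ → ℝ := fun s => χ₁ s * H s + χ s * H₁ s
  let G₂ : ℝ → ℝ := fun s => (χ₂ s * H s + χ₁ s * H₁ s) + (χ₁ s * H₁ s + χ s * H₂ s)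
  have hG1 : ∀ s, 0 ≤ s → HasDerivAt G (G₁ s) s := fun s hs => (hd1 s).mul (hH1 s hs)
  have hG2 : ∀ s, 0 ≤ s → HasDerivAt G₁ (G₂ s) s := fun s hs =>
    ((hd2 s).mul (hH1 s hs)).add ((hd1 s).mul (hH2 s hs))
  have hcd : ContDiff ℝ 2 fun y : Euc n => G (‖y - 0‖ ^ 2) := by
    refine ContDiff.mul (hχ.comp ((contDiff_id.sub contDiff_const).norm_sq ℝ)) ?_
    exact contDiff_max_zero_cube.comp
      (contDiff_const.sub (contDiff_const.mul (contDiff_add_rpow_neg (0 : Euc n) hb0 m)))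
  have hlap : ∀ y : Euc n, ∀ s, s = ‖y‖ ^ 2 → lap (fun y : Euc n => G (‖y - 0‖ ^ 2)) y =
      χ s * (24 * s * Q s * P₁ s ^ 2 + 3 * Q s ^ 2 * (4 * s * P₂ s + 2 * n * P₁ s)) +
      (24 * s * χ₁ s * Q s ^ 2 * P₁ s + (4 * s * χ₂ s + 2 * n * χ₁ s) * Q s ^ 3) := by
    intro y s hs
    rw [lap_radial 0 hG1 hG2 hcd y, sub_zero, ← hs]
    simp only [G₁, G₂, H, H₁, H₂]
    ring
  have hmain : ∀ s, 0 ≤ s → 0 ≤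
      24 * s * Q s * P₁ s ^ 2 + 3 * Q s ^ 2 * (4 * s * P₂ s + 2 * n * P₁ s) := fun s hs =>
    add_nonneg (by have := hQ0 s; positivity)
      (mul_nonneg (by positivity) (hPsub s hs))
  have hPhalf : ∀ s, 16 * b ≤ s → 1 / 2 ≤ Q s := fun s hs => by
    refine le_trans ?_ (le_max_left _ _)
    have e : b ^ m * (s + b) ^ (-m) ≤ 1 / 4 := by
      calc b ^ m * (s + b) ^ (-m) ≤ b ^ m * (16 * b) ^ (-m) := by
            refine mul_le_mul_of_nonneg_left ?_ (by positivity)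
            exact Real.rpow_le_rpow_of_nonpos (by positivity) (by linarith) (by linarith)
        _ = 16 ^ (-m) := by
            rw [Real.mul_rpow (by norm_num) hb0.le, Real.rpow_neg hb0.le]
            field_simp
        _ ≤ 16 ^ (-(1 / 2 : ℝ)) :=
            Real.rpow_le_rpow_of_exponent_le (by norm_num) (by linarith)
        _ = 1 / 4 := by
            rw [show (16 : ℝ) = 4 ^ (2 : ℝ) by norm_num, ← Real.rpow_mul (by norm_num)]
            norm_num [Real.rpow_neg_one]
    simp only [P]
    linarith
  have hmem : ∀ y : Euc n, y ∈ closedBall (0 : Euc n) 1 ↔ ‖y‖ ^ 2 ≤ 1 := by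
    intro y
    rw [mem_closedBall_zero_iff, sq_le_one_iff₀ (norm_nonneg _)]
  have hlt : ∀ y : Euc n, ‖y‖ < 1 / 2 → ‖y‖ ^ 2 < 1 / 4 := fun y hy => by
    have := pow_lt_pow_left₀ hy (norm_nonneg _) (two_ne_zero)
    norm_num at this ⊢
    exact this
  refine ⟨_, hcd, subset_sdiff_singleton ?_ ?_, ?_, ?_, ?_, ?_, ?_, ?_⟩
  · refine closure_minimal (fun y hy => ?_) isClosed_closedBall
    by_contra hc
    rw [hmem, not_le] at hc
    exact hy (by simp only [G, sub_zero]; rw [hzero _ hc.le, zero_mul])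
  · rw [notMem_tsupport_iff_eventuallyEq]
    have hc : ContinuousAt (fun y : Euc n => P (‖y - 0‖ ^ 2)) 0 :=
      (contDiff_const.sub (contDiff_const.mul
        (contDiff_add_rpow_neg (0 : Euc n) hb0 m))).continuous.continuousAt
    have hneg : P (‖(0 : Euc n) - 0‖ ^ 2) < 0 := by
      simp only [P, sub_self, norm_zero, ne_eq, OfNat.ofNat_ne_zero, not_false_eq_true, zero_pow,
        zero_add]
      rw [mul_assoc, ← Real.rpow_add hb0]
      norm_num
    filter_upwards [hc.eventually_lt continuousAt_const hneg] with y hy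
    simp only [G, H, Q, max_eq_right hy.le]
    simp
  · intro y
    exact mul_nonneg (h0 _) (pow_nonneg (hQ0 _) 3)
  · intro y hy1 hy2
    have e1 : ‖y‖ ^ 2 ≤ 1 / 4 := by nlinarith [norm_nonneg y]
    have e2 : 16 * b ≤ ‖y‖ ^ 2 := by rw [hb]; nlinarith
    simp only [G, H, sub_zero]
    rw [hone _ e1, one_mul]
    have := pow_le_pow_left₀ (by norm_num) (hPhalf _ e2) 3
    norm_num at this ⊢
    exact this
  · intro y
    rw [hlap y _ rfl]
    set s := ‖y‖ ^ 2 with hs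
    have hs0 : 0 ≤ s := by positivity
    have hA : 0 ≤ χ s * (24 * s * Q s * P₁ s ^ 2 + 3 * Q s ^ 2 * (4 * s * P₂ s + 2 * n * P₁ s)) :=
      mul_nonneg (h0 s) (hmain s hs0)
    by_cases ht : s < 1 / 4 ∨ 1 < s
    · rw [(hout _ ht).1, (hout _ ht).2]
      simp only [mul_zero, zero_mul, add_zero]
      have : 0 ≤ 24 * D * (2 * m * 4 ^ (m + 1)) + D * (4 + 2 * n) := by positivity
      linarith
    · push Not at ht
      have k1 : P₁ s ≤ 2 * m * 4 ^ (m + 1) := by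
        have e1 : (s + b) ^ (-(m + 1)) ≤ 4 ^ (m + 1) := by
          refine (Real.rpow_le_rpow_of_nonpos (x := 1 / 4) (by norm_num) (by linarith)
            (by linarith)).trans_eq ?_
          rw [one_div, Real.inv_rpow (by norm_num), Real.rpow_neg (by norm_num), inv_inv]
        have e2 : b ^ m ≤ 1 := Real.rpow_le_one hb0.le hb1' hm0'.le
        calc P₁ s ≤ 2 * m * 1 * 4 ^ (m + 1) := by
              simp only [P₁]
              gcongr
          _ = _ := by ring
      have q2 : Q s ^ 2 ≤ 1 := pow_le_one₀ (hQ0 s) (hQ1 s hs0)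
      have q3 : Q s ^ 3 ≤ 1 := pow_le_one₀ (hQ0 s) (hQ1 s hs0)
      have q3' : 0 ≤ Q s ^ 3 := pow_nonneg (hQ0 s) 3
      have x1 := neg_le_of_abs_le (hb1 s)
      have x2 := neg_le_of_abs_le (hb2 s)
      have t1 : -(24 * D * (2 * m * 4 ^ (m + 1))) ≤ 24 * s * χ₁ s * Q s ^ 2 * P₁ s := by
        have y1 : -D ≤ s * χ₁ s := by nlinarith [ht.2]
        have y2 : Q s ^ 2 * P₁ s ≤ 2 * m * 4 ^ (m + 1) :=
          (mul_le_of_le_one_left (hP1nn s hs0) q2).trans k1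
        have y3 : 0 ≤ Q s ^ 2 * P₁ s := mul_nonneg (sq_nonneg _) (hP1nn s hs0)
        calc -(24 * D * (2 * m * 4 ^ (m + 1))) = 24 * (-(D * (2 * m * 4 ^ (m + 1)))) := by ring
          _ ≤ 24 * (-(D * (Q s ^ 2 * P₁ s))) := by gcongr
          _ = 24 * ((-D) * (Q s ^ 2 * P₁ s)) := by ring
          _ ≤ 24 * ((s * χ₁ s) * (Q s ^ 2 * P₁ s)) := by gcongr
          _ = _ := by ring
      have t2 : -(D * (4 + 2 * n)) ≤ (4 * s * χ₂ s + 2 * n * χ₁ s) * Q s ^ 3 := by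
        have y1 : -D ≤ s * χ₂ s := by nlinarith [ht.2]
        have y2 : -(D * (4 + 2 * n)) ≤ 4 * s * χ₂ s + 2 * n * χ₁ s := by nlinarith
        have y3 : 0 ≤ D * (4 + 2 * n) := by positivity
        nlinarith
      linarith
  · intro y hy
    have h4 := hlt y hy
    rw [hlap y _ rfl, hone _ h4.le, (hout _ (Or.inl h4)).1, (hout _ (Or.inl h4)).2]
    have := hmain (‖y‖ ^ 2) (by positivity)
    simpa using this
  · intro y hy
    rw [hmem, not_le] at hy
    rw [hlap y _ rfl, hzero _ hy.le, (hout _ (Or.inr hy)).1, (hout _ (Or.inr hy)).2]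
    simp
  · intro y hy1 hy2 hy
    have h4 := hlt y hy
    rw [hlap y _ rfl, hone _ h4.le, (hout _ (Or.inl h4)).1, (hout _ (Or.inl h4)).2]
    simp only [one_mul, mul_zero, zero_mul, add_zero]
    have e2 : 16 * b ≤ ‖y‖ ^ 2 := by rw [hb]; nlinarith
    have e3 : ‖y‖ ^ 2 ≤ 256 * b := by rw [hb]; nlinarith [norm_nonneg y]
    set s := ‖y‖ ^ 2 with hs
    have hs0 : 0 ≤ s := by positivity
    have k : 2 * m * 257 ^ (-(m + 1)) / b ≤ P₁ s := by
      have : (257 * b) ^ (-(m + 1)) ≤ (s + b) ^ (-(m + 1)) :=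
        Real.rpow_le_rpow_of_nonpos (hsb s hs0) (by linarith) (by linarith)
      calc 2 * m * 257 ^ (-(m + 1)) / b = 2 * m * b ^ m * (257 * b) ^ (-(m + 1)) := by
            rw [Real.mul_rpow (by norm_num) hb0.le, show (-(m + 1)) = -m + -1 by ring,
              Real.rpow_add hb0, Real.rpow_neg_one, Real.rpow_neg hb0.le]
            field_simp
        _ ≤ P₁ s := by
            simp only [P₁]
            gcongr
    have hrest : 0 ≤ 3 * Q s ^ 2 * (4 * s * P₂ s + 2 * n * P₁ s) :=
      mul_nonneg (by positivity) (hPsub s hs0)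
    have hk0 : 0 ≤ 2 * m * 257 ^ (-(m + 1)) / b := by positivity
    calc 24 * 16 * (1 / 2) * (2 * m * 257 ^ (-(m + 1))) ^ 2 / b
        = 24 * (16 * b) * (1 / 2) * (2 * m * 257 ^ (-(m + 1)) / b) ^ 2 := by field_simp
      _ ≤ 24 * s * Q s * P₁ s ^ 2 := by
          have := hPhalf s e2
          gcongr
      _ ≤ _ := by linarith

lemma lap_eq_zero_of_notMem_tsupport {n : ℕ} {φ : Euc n → ℝ} {x : Euc n} (hx : x ∉ tsupport φ) :
    lap φ x = 0 := by
  have h : iteratedFDeriv ℝ 2 φ x = 0 := by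
    by_contra h
    exact hx (tsupport_iteratedFDeriv_subset 2 (subset_tsupport _ h))
  simp [lap, h]

lemma integrable_and_integral_green_eq_zero {n : ℕ} {Ω : Set (Euc n)} (hΩ : IsOpen Ω)
    {u φ : Euc n → ℝ} (hu : ContDiffOn ℝ 2 u Ω) (hφ : ContDiff ℝ 2 φ) (hc : HasCompactSupport φ)
    (hs : tsupport φ ⊆ Ω) : Integrable (fun x => u x * lap φ x + -lap u x * φ x) ∧
      ∫ x, (u x * lap φ x + -lap u x * φ x) = 0 := by
  have hsub : tsupport (lap φ) ⊆ tsupport φ :=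
    closure_minimal (fun x hx => by
      by_contra h
      exact hx (lap_eq_zero_of_notMem_tsupport h)) (isClosed_tsupport φ)
  have hlc : Continuous (lap φ) :=
    continuousOn_univ.1 (continuousOn_lap isOpen_univ hφ.contDiffOn)
  have i1 := integrable_mul_of_tsupport_subset hΩ hu.continuousOn hlc
    (hc.mono' (subset_closure.trans hsub)) (hsub.trans hs)
  have i2 : Integrable (fun x => -lap u x * φ x) :=
    integrable_mul_of_tsupport_subset hΩ (continuousOn_lap hΩ hu).neg hφ.continuous hc hs
  refine ⟨i1.add i2, ?_⟩
  have h := integral_mul_lap_eq hΩ hu hφ hc hs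
  rw [integral_add i1 i2]
  simp only [neg_mul]
  rw [integral_neg, h, add_neg_cancel]

lemma lintegral_ofReal_le_of_integral_eq_zero {α : Type*} [MeasurableSpace α] {μ : Measure α}
    {g P Q : α → ℝ} (hg : Integrable g μ) (h0 : ∫ x, g x ∂μ = 0) (hP : ∀ x, 0 ≤ P x)
    (hQ : ∀ x, 0 ≤ Q x) (h : ∀ᵐ x ∂μ, P x ≤ Q x + g x) :
    ∫⁻ x, ENNReal.ofReal (P x) ∂μ ≤ ∫⁻ x, ENNReal.ofReal (Q x) ∂μ := by
  have hfin1 : ∫⁻ x, ENNReal.ofReal (g x) ∂μ ≠ ⊤ := hg.lintegral_lt_top.ne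
  have hfin2 : ∫⁻ x, ENNReal.ofReal (-g x) ∂μ ≠ ⊤ := hg.neg.lintegral_lt_top.ne
  have heq : ∫⁻ x, ENNReal.ofReal (g x) ∂μ = ∫⁻ x, ENNReal.ofReal (-g x) ∂μ := by
    rw [integral_eq_lintegral_pos_part_sub_lintegral_neg_part hg, sub_eq_zero] at h0
    exact (ENNReal.toReal_eq_toReal_iff' hfin1 hfin2).1 h0
  have hle : ∫⁻ x, (ENNReal.ofReal (P x) + ENNReal.ofReal (-g x)) ∂μ ≤
      ∫⁻ x, (ENNReal.ofReal (Q x) + ENNReal.ofReal (g x)) ∂μ := by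
    refine lintegral_mono_ae ?_
    filter_upwards [h] with x hx
    have hp := hP x
    rcases le_total 0 (g x) with hg0 | hg0
    · rw [ENNReal.ofReal_of_nonpos (neg_nonpos.2 hg0), add_zero,
        ← ENNReal.ofReal_add (hQ x) hg0]
      exact ENNReal.ofReal_le_ofReal hx
    · rw [ENNReal.ofReal_of_nonpos hg0, add_zero,
        ← ENNReal.ofReal_add hp (neg_nonneg.2 hg0)]
      exact ENNReal.ofReal_le_ofReal (by linarith)
  have hm : AEMeasurable (fun x => ENNReal.ofReal (-g x)) μ := hg.neg.aemeasurable.ennreal_ofReal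
  rw [lintegral_add_right' _ hm,
    lintegral_add_right' _ hg.aemeasurable.ennreal_ofReal, heq] at hle
  exact (ENNReal.add_le_add_iff_right hfin2).1 hle

lemma lintegral_ofReal_indicator {α : Type*} [MeasurableSpace α] {μ : Measure α} {S : Set α}
    (hS : MeasurableSet S) (g : α → ℝ) :
    ∫⁻ x, ENNReal.ofReal (S.indicator g x) ∂μ = ∫⁻ x in S, ENNReal.ofReal (g x) ∂μ := by
  rw [← lintegral_indicator hS]
  refine lintegral_congr fun x => ?_
  by_cases h : x ∈ S <;> simp [h]

lemma exists_puncture_bound {n : ℕ} (hn : 3 ≤ n) {u : Euc n → ℝ} (hu0 : ∀ x, 0 ≤ u x)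
    (hu : ContDiffOn ℝ 2 u {0}ᶜ) (hf : ∀ x ∈ ball (0 : Euc n) 2 \ {0}, 0 ≤ -lap u x) :
    ∃ (K : ENNReal) (c : ℝ), K ≠ ⊤ ∧ 0 < c ∧ ∀ ε : ℝ, 0 < ε → ε ≤ 1 →
      (∫⁻ y in {y : Euc n | 4 * ε ≤ ‖y‖ ∧ ‖y‖ < 1 / 2}, ENNReal.ofReal (-lap u y / 8)) ≤ K ∧
      (∫⁻ y in {y : Euc n | 4 * ε ≤ ‖y‖ ∧ ‖y‖ ≤ 16 * ε ∧ ‖y‖ < 1 / 2},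
        ENNReal.ofReal (c / ε ^ 2 * u y)) ≤ K := by
  obtain ⟨C, c, hC, hc, hφ⟩ := exists_test_function_puncture hn
  set A : Set (Euc n) := closedBall 0 1 \ ball 0 (1 / 2) with hA
  have hAm : MeasurableSet A := measurableSet_closedBall.diff measurableSet_ball
  have hAc : IsCompact A := (isCompact_closedBall 0 1).diff isOpen_ball
  have hA0 : A ⊆ {0}ᶜ := by
    rintro y ⟨-, hy⟩ rfl
    exact hy (mem_ball_self (by norm_num))
  have hK : ∫⁻ y in A, ENNReal.ofReal (C * u y) ≠ ⊤ :=
    (((hu.continuousOn.mono hA0).const_smul C).integrableOn_compact hAc).lintegral_lt_top.ne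
  refine ⟨∫⁻ y in A, ENNReal.ofReal (C * u y), c, hK, hc, fun ε hε hε1 => ?_⟩
  obtain ⟨φ, hφ2, hφs, hφ0, hφ8, hφC, hφl, hφout, hφc⟩ := hφ ε hε hε1
  have hcs : HasCompactSupport φ :=
    HasCompactSupport.of_support_subset_isCompact (isCompact_closedBall 0 1)
      ((subset_tsupport φ).trans (hφs.trans sdiff_subset))
  obtain ⟨hg, hg0⟩ := integrable_and_integral_green_eq_zero isOpen_compl_singleton hu hφ2 hcs
    (hφs.trans fun y hy => hy.2)
  have key : ∀ (S : Set (Euc n)) (p : Euc n → ℝ), MeasurableSet S →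
      (∀ y ∈ S, 0 ≤ p y ∧ 0 < ‖y‖ ∧ ‖y‖ < 1 / 2) →
      (∀ y ∈ S, p y ≤ u y * lap φ y + -lap u y * φ y) →
      ∫⁻ y in S, ENNReal.ofReal (p y) ≤ ∫⁻ y in A, ENNReal.ofReal (C * u y) := by
    intro S p hS hp hle
    rw [← lintegral_ofReal_indicator hS, ← lintegral_ofReal_indicator hAm]
    refine lintegral_ofReal_le_of_integral_eq_zero hg hg0
      (indicator_nonneg fun y hy => (hp y hy).1)
      (indicator_nonneg fun y _ => mul_nonneg hC.le (hu0 y)) ?_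
    have : Nonempty (Fin n) := ⟨⟨0, by omega⟩⟩
    filter_upwards [compl_mem_ae_iff.2 (measure_singleton (0 : Euc n))] with y hy
    have hy0 : y ≠ 0 := hy
    by_cases hyS : y ∈ S
    · have hyA : y ∉ A := fun h => h.2 (by simpa using (hp y hyS).2.2)
      rw [indicator_of_mem hyS, indicator_of_notMem hyA, zero_add]
      exact hle y hyS
    rw [indicator_of_notMem hyS]
    by_cases hy1 : y ∈ closedBall (0 : Euc n) 1
    · have hfy : 0 ≤ -lap u y * φ y := mul_nonneg
        (hf y ⟨closedBall_subset_ball (by norm_num) hy1, hy0⟩) (hφ0 y)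
      by_cases hyA : y ∈ A
      · rw [indicator_of_mem hyA]
        nlinarith [hφC y, hu0 y]
      · rw [indicator_of_notMem hyA]
        have hy2 : ‖y‖ < 1 / 2 := by
          by_contra h
          exact hyA ⟨hy1, by simpa using h⟩
        have := mul_nonneg (hu0 y) (hφl y hy2)
        linarith
    · have h1 : φ y = 0 := image_eq_zero_of_notMem_tsupport fun h => hy1 (hφs h).1
      rw [hφout y hy1, h1, indicator_of_notMem fun h => hy1 h.1]
      simp
  constructor
  · refine key _ (fun y => -lap u y / 8)
      ((measurableSet_le measurable_const measurable_norm).inter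
        (measurableSet_lt measurable_norm measurable_const)) ?_ ?_
    · rintro y ⟨h1, h2⟩
      have h3 : 0 < ‖y‖ := by linarith
      exact ⟨div_nonneg (hf y ⟨by simpa using (by linarith : ‖y‖ < 2), norm_pos_iff.1 h3⟩)
        (by norm_num), h3, h2⟩
    · rintro y ⟨h1, h2⟩
      have h3 : 0 < ‖y‖ := by linarith
      have h4 := hf y ⟨by simpa using (by linarith : ‖y‖ < 2), norm_pos_iff.1 h3⟩
      have h5 := hφ8 y h1 h2.le
      have := mul_nonneg (hu0 y) (hφl y h2)
      nlinarith
  · refine key _ (fun y => c / ε ^ 2 * u y)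
      ((measurableSet_le measurable_const measurable_norm).inter
        ((measurableSet_le measurable_norm measurable_const).inter
        (measurableSet_lt measurable_norm measurable_const))) ?_ ?_
    · rintro y ⟨h1, h2, h3⟩
      exact ⟨mul_nonneg (by positivity) (hu0 y), by linarith, h3⟩
    · rintro y ⟨h1, h2, h3⟩
      have h3' : 0 < ‖y‖ := by linarith
      have h4 := hf y ⟨by simpa using (by linarith : ‖y‖ < 2), norm_pos_iff.1 h3'⟩
      have h5 := mul_le_mul_of_nonneg_left (hφc y h1 h2 h3) (hu0 y)
      have := mul_nonneg h4 (hφ0 y)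
      linarith

lemma lintegral_neg_lap_ne_top {n : ℕ} (hn : 3 ≤ n) {u : Euc n → ℝ} (hu0 : ∀ x, 0 ≤ u x)
    (hu : ContDiffOn ℝ 2 u {0}ᶜ) (hf : ∀ x ∈ ball (0 : Euc n) 2 \ {0}, 0 ≤ -lap u x) :
    ∫⁻ y in ball (0 : Euc n) (1 / 2), ENNReal.ofReal (-lap u y) ≠ ⊤ := by
  have : Nonempty (Fin n) := ⟨⟨0, by omega⟩⟩
  obtain ⟨K, c, hK, -, h⟩ := exists_puncture_bound hn hu0 hu hf
  set S : ℕ → Set (Euc n) := fun k => {y | 4 * (1 / ((k : ℝ) + 1)) ≤ ‖y‖ ∧ ‖y‖ < 1 / 2} with hS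
  have hmono : Monotone S := by
    intro i j hij y hy
    refine ⟨le_trans ?_ hy.1, hy.2⟩
    have : 1 / ((j : ℝ) + 1) ≤ 1 / ((i : ℝ) + 1) := one_div_le_one_div_of_le (by positivity)
      (by exact_mod_cast Nat.add_le_add_right hij 1)
    linarith
  have hun : ball (0 : Euc n) (1 / 2) ⊆ (⋃ k, S k) ∪ {0} := by
    intro y hy
    by_cases hy0 : y = 0
    · exact Or.inr hy0
    · obtain ⟨k, hk⟩ := exists_nat_one_div_lt (show 0 < ‖y‖ / 4 by positivity)
      exact Or.inl (mem_iUnion.2 ⟨k, by linarith, by simpa using hy⟩)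
  have h8 : ∀ y, ENNReal.ofReal (-lap u y) = 8 * ENNReal.ofReal (-lap u y / 8) := by
    intro y
    rw [← ENNReal.ofReal_ofNat 8, ← ENNReal.ofReal_mul (by norm_num)]
    congr 1
    ring
  have hle : ∫⁻ y in ball (0 : Euc n) (1 / 2), ENNReal.ofReal (-lap u y) ≤ 8 * K := by
    simp_rw [h8]
    rw [lintegral_const_mul' _ _ (by norm_num)]
    gcongr
    refine (lintegral_mono_set hun).trans ((lintegral_union_le _ _ _).trans ?_)
    rw [setLIntegral_measure_zero _ _ (measure_singleton _), add_zero,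
      setLIntegral_iUnion_of_directed _ hmono.directed_le]
    refine iSup_le fun k => (h _ (by positivity) ?_).1
    rw [div_le_one (by positivity)]
    linarith [Nat.cast_nonneg (α := ℝ) k]
  exact ne_top_of_le_ne_top (ENNReal.mul_ne_top (by norm_num) hK) hle

lemma exists_lintegral_ball_half_norm_le {n : ℕ} (hn : 3 ≤ n) {u : Euc n → ℝ}
    (hu0 : ∀ x, 0 ≤ u x) (hu : ContDiffOn ℝ 2 u {0}ᶜ)
    (hf : ∀ x ∈ ball (0 : Euc n) 2 \ {0}, 0 ≤ -lap u x) :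
    ∃ C : ENNReal, C ≠ ⊤ ∧ ∀ x : Euc n, x ≠ 0 → ‖x‖ < 1 / 4 →
      ∫⁻ y in closedBall x (‖x‖ / 2), ENNReal.ofReal (u y) ≤ C * ENNReal.ofReal (‖x‖ ^ 2) := by
  obtain ⟨K, c, hK, hc, h⟩ := exists_puncture_bound hn hu0 hu hf
  refine ⟨K * ENNReal.ofReal (1 / (64 * c)), ENNReal.mul_ne_top hK ENNReal.ofReal_ne_top,
    fun x hx hx4 => ?_⟩
  have hx0 : 0 < ‖x‖ := norm_pos_iff.2 hx
  have h2 := (h (‖x‖ / 8) (by positivity) (by linarith)).2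
  have hsub : closedBall x (‖x‖ / 2) ⊆
      {y : Euc n | 4 * (‖x‖ / 8) ≤ ‖y‖ ∧ ‖y‖ ≤ 16 * (‖x‖ / 8) ∧ ‖y‖ < 1 / 2} := by
    intro y hy
    rw [mem_closedBall, dist_eq_norm] at hy
    have h3 := norm_sub_norm_le x y
    have h4 := norm_sub_norm_le y x
    rw [norm_sub_rev] at h3
    exact ⟨by linarith, by linarith, by linarith⟩
  have h3 := (lintegral_mono_set hsub).trans h2
  calc ∫⁻ y in closedBall x (‖x‖ / 2), ENNReal.ofReal (u y)
      = ∫⁻ y in closedBall x (‖x‖ / 2), ENNReal.ofReal (‖x‖ ^ 2 * (1 / (64 * c))) *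
          ENNReal.ofReal (c / (‖x‖ / 8) ^ 2 * u y) := by
        refine lintegral_congr fun y => ?_
        rw [← ENNReal.ofReal_mul (by positivity)]
        congr 1
        field_simp
        norm_num
    _ ≤ ENNReal.ofReal (‖x‖ ^ 2 * (1 / (64 * c))) * K := by
        rw [lintegral_const_mul' _ _ ENNReal.ofReal_ne_top]
        gcongr
    _ = _ := by
        rw [ENNReal.ofReal_mul (by positivity)]
        ring

lemma ofReal_norm_rpow_neg_le {E : Type*} [NormedAddCommGroup E] (x : E) {s : ℝ} (hs : 0 ≤ s) :
    ENNReal.ofReal (‖x‖ ^ (-s)) ≤ ‖x‖ₑ ^ (-s) := by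
  rcases hs.eq_or_lt with rfl | hs
  · simp
  by_cases hx : x = 0
  · simp [hx, ENNReal.zero_rpow_of_neg (neg_lt_zero.2 hs)]
  · rw [← ENNReal.ofReal_rpow_of_pos (norm_pos_iff.2 hx), ofReal_norm]

lemma exists_mean_value_bound {n : ℕ} (hn : 3 ≤ n) : ∃ C : ENNReal, C ≠ ⊤ ∧
    ∀ (Ω : Set (Euc n)) (u : Euc n → ℝ) (a : Euc n) (r : ℝ), IsOpen Ω → ContDiffOn ℝ 2 u Ω →
      0 < r → closedBall a r ⊆ Ω → (∀ y ∈ closedBall a r, 0 ≤ u y) →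
      (∀ y ∈ closedBall a r, 0 ≤ -lap u y) →
      ENNReal.ofReal (u a) ≤ C * (ENNReal.ofReal (r ^ (-(n : ℝ))) *
        (∫⁻ y in closedBall a r, ENNReal.ofReal (u y)) +
        ∫⁻ y in closedBall a r, ‖y - a‖ₑ ^ (-((n : ℝ) - 2)) * ENNReal.ofReal (-lap u y)) := by
  have hNe : Nonempty (Fin n) := ⟨⟨0, by omega⟩⟩
  have hn3 : (3 : ℝ) ≤ n := by exact_mod_cast hn
  obtain ⟨C, c, hC, hc, hφ⟩ := exists_test_function_ball hn
  set V : ENNReal := volume (ball (0 : Euc n) 1) with hV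
  have hV0 : V ≠ 0 := (measure_ball_pos _ _ one_pos).ne'
  have hVt : V ≠ ⊤ := measure_ball_lt_top.ne
  have hcV0 : ENNReal.ofReal c * V ≠ 0 := mul_ne_zero (ENNReal.ofReal_pos.2 hc).ne' hV0
  have hcVt : ENNReal.ofReal c * V ≠ ⊤ := ENNReal.mul_ne_top ENNReal.ofReal_ne_top hVt
  refine ⟨(ENNReal.ofReal c * V)⁻¹ * (ENNReal.ofReal C + 1), ENNReal.mul_ne_top
    (ENNReal.inv_ne_top.2 hcV0) (ENNReal.add_ne_top.2 ⟨ENNReal.ofReal_ne_top, ENNReal.one_ne_top⟩),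
    fun Ω u a r hΩ hu hr hsub hu0 hf => ?_⟩
  have hclos : MeasurableSet (closedBall a r) := measurableSet_closedBall
  set I₁ := ∫⁻ y in closedBall a r, ENNReal.ofReal (u y) with hI₁
  set I₂ := ∫⁻ y in closedBall a r, ‖y - a‖ₑ ^ (-((n : ℝ) - 2)) * ENNReal.ofReal (-lap u y) with hI₂
  have ha : a ∈ closedBall a r := mem_closedBall_self hr.le
  set q : Euc n → ℝ := fun y =>
    C * r ^ (-(n : ℝ)) * u y + ‖y - a‖ ^ (-((n : ℝ) - 2)) * -lap u y with hq
  have hQ : ∫⁻ y in closedBall a r, ENNReal.ofReal (q y) ≤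
      (ENNReal.ofReal C + 1) * (ENNReal.ofReal (r ^ (-(n : ℝ))) * I₁ + I₂) := by
    have hum : AEMeasurable u (volume.restrict (closedBall a r)) :=
      (hu.continuousOn.mono hsub).aemeasurable hclos
    calc ∫⁻ y in closedBall a r, ENNReal.ofReal (q y)
        ≤ ∫⁻ y in closedBall a r, (ENNReal.ofReal C * ENNReal.ofReal (r ^ (-(n : ℝ))) *
            ENNReal.ofReal (u y) + ‖y - a‖ₑ ^ (-((n : ℝ) - 2)) * ENNReal.ofReal (-lap u y)) := by
          refine lintegral_mono fun y => ENNReal.ofReal_add_le.trans ?_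
          rw [ENNReal.ofReal_mul (by positivity), ENNReal.ofReal_mul hC.le,
            ENNReal.ofReal_mul (by positivity)]
          gcongr
          exact ofReal_norm_rpow_neg_le _ (by linarith)
      _ = ENNReal.ofReal C * (ENNReal.ofReal (r ^ (-(n : ℝ))) * I₁) + I₂ := by
          rw [lintegral_add_left' (hum.ennreal_ofReal.const_mul _), lintegral_const_mul' _ _
            (ENNReal.mul_ne_top ENNReal.ofReal_ne_top ENNReal.ofReal_ne_top), mul_assoc]
      _ ≤ (ENNReal.ofReal C + 1) * (ENNReal.ofReal (r ^ (-(n : ℝ))) * I₁ + I₂) := by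
          rw [add_mul, one_mul, mul_add]
          exact add_le_add le_self_add le_add_self
  refine le_of_forall_lt fun b hb => ?_
  obtain ⟨b', hbb', hb'⟩ := exists_between hb
  refine hbb'.trans_le ?_
  have hb't : b' ≠ ⊤ := (hb'.trans_le le_top).ne
  set t : ℝ := b'.toReal with ht
  have ht0 : 0 ≤ t := ENNReal.toReal_nonneg
  have htu : t < u a := by rwa [ht, ← ENNReal.lt_ofReal_iff_toReal_lt hb't]
  have hbt : b' = ENNReal.ofReal t := (ENNReal.ofReal_toReal hb't).symm
  have hcont : ContinuousAt u a := hu.continuousOn.continuousAt (hΩ.mem_nhds (hsub ha))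
  obtain ⟨δ, hδ, hδu⟩ := Metric.eventually_nhds_iff_ball.1 (hcont.eventually (lt_mem_nhds htu))
  set ε : ℝ := min δ (r / 2) with hε
  have hε0 : 0 < ε := lt_min hδ (by linarith)
  obtain ⟨φ, hφ2, hφs, hφ0, hφle, hφl, hφC, hφout⟩ := hφ a r ε hε0 (min_le_right _ _)
  have hcs : HasCompactSupport φ := HasCompactSupport.of_support_subset_isCompact
    (isCompact_closedBall a r) ((subset_tsupport φ).trans hφs)
  obtain ⟨hg, hg0⟩ := integrable_and_integral_green_eq_zero hΩ hu hφ2 hcs (hφs.trans hsub)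
  have hballs : ball a ε ⊆ closedBall a r :=
    (ball_subset_ball ((min_le_right _ _).trans (by linarith))).trans ball_subset_closedBall
  have hmain : ∫⁻ y in ball a ε, ENNReal.ofReal (c * ε ^ (-(n : ℝ)) * t) ≤
      ∫⁻ y in closedBall a r, ENNReal.ofReal (q y) := by
    rw [← lintegral_ofReal_indicator hclos,
      ← lintegral_ofReal_indicator (measurableSet_ball (x := a) (ε := ε))
        fun _ => c * ε ^ (-(n : ℝ)) * t]
    refine lintegral_ofReal_le_of_integral_eq_zero hg.neg ?_
      (indicator_nonneg fun y _ => by positivity) (indicator_nonneg fun y hy => ?_) ?_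
    · simp only [Pi.neg_apply]
      rw [integral_neg, hg0, neg_zero]
    · exact add_nonneg (mul_nonneg (by positivity) (hu0 y hy))
        (mul_nonneg (by positivity) (hf y hy))
    · filter_upwards [compl_mem_ae_iff.2 (measure_singleton a)] with y hy
      have hya : y ≠ a := hy
      simp only [Pi.neg_apply]
      by_cases hyr : y ∈ closedBall a r
      · have h1 := mul_le_mul_of_nonneg_left (hφle y hya) (hf y hyr)
        rw [indicator_of_mem hyr, hq]
        by_cases hyε : y ∈ ball a ε
        · have h2 := mul_le_mul_of_nonneg_left (hφl y hyε) (hu0 y hyr)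
          have h3 : t < u y := hδu y (ball_subset_ball (min_le_left _ _) hyε)
          have h4 : c * ε ^ (-(n : ℝ)) * t ≤ c * ε ^ (-(n : ℝ)) * u y := by gcongr
          have h5 : 0 ≤ C * r ^ (-(n : ℝ)) * u y := mul_nonneg (by positivity) (hu0 y hyr)
          rw [indicator_of_mem hyε]
          linarith
        · have h2 := mul_le_mul_of_nonneg_left (hφC y) (hu0 y hyr)
          rw [indicator_of_notMem hyε]
          linarith
      · have h1 : φ y = 0 := image_eq_zero_of_notMem_tsupport fun h => hyr (hφs h)
        rw [hφout y hyr, h1, indicator_of_notMem hyr, indicator_of_notMem fun h => hyr (hballs h)]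
        simp
  have hval : ∫⁻ y in ball a ε, ENNReal.ofReal (c * ε ^ (-(n : ℝ)) * t) =
      (ENNReal.ofReal c * V) * b' := by
    rw [setLIntegral_const, Measure.addHaar_ball _ _ hε0.le, hbt, finrank_euclideanSpace_fin,
      ← mul_assoc, ← ENNReal.ofReal_mul (by positivity), mul_right_comm (ENNReal.ofReal c),
      ← ENNReal.ofReal_mul hc.le]
    congr 2
    rw [Real.rpow_neg hε0.le, Real.rpow_natCast]
    field_simp
  rw [hval] at hmain
  rw [mul_assoc]
  calc b' = (ENNReal.ofReal c * V)⁻¹ * (ENNReal.ofReal c * V * b') := by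
        rw [← mul_assoc, ENNReal.inv_mul_cancel hcV0 hcVt, one_mul]
    _ ≤ _ := mul_le_mul' le_rfl (hmain.trans hQ)

lemma aemeasurable_of_continuousOn_compl_singleton {n : ℕ} (hn : 1 ≤ n) {g : Euc n → ℝ} {a : Euc n}
    (hg : ContinuousOn g {a}ᶜ) : AEMeasurable g := by
  have : Nonempty (Fin n) := ⟨⟨0, hn⟩⟩
  have h := hg.aemeasurable (μ := volume) (measurableSet_singleton a).compl
  have e : volume.restrict ({a}ᶜ : Set (Euc n)) = volume :=
    Measure.restrict_eq_self_of_ae_mem (compl_mem_ae_iff.2 (measure_singleton a))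
  rwa [e] at h

lemma exists_potential_bound {n : ℕ} (hn : 3 ≤ n) {u : Euc n → ℝ} (hu0 : ∀ x, 0 ≤ u x)
    (hu : ContDiffOn ℝ 2 u {0}ᶜ) (hf : ∀ x ∈ ball (0 : Euc n) 2 \ {0}, 0 ≤ -lap u x) :
    ∃ (μ : Measure (Euc n)) (C : ENNReal), IsFiniteMeasure μ ∧ C ≠ ⊤ ∧
      ∀ x, x ≠ 0 → ‖x‖ < 1 / 4 →
        ENNReal.ofReal (u x) ≤ C * ∫⁻ z, ‖x - z‖ₑ ^ (-((n : ℝ) - 2)) ∂μ := by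
  have hn3 : (3 : ℝ) ≤ n := by exact_mod_cast hn
  obtain ⟨C₁, hC₁, hmv⟩ := exists_mean_value_bound hn
  obtain ⟨C₂, hC₂, hhalf⟩ := exists_lintegral_ball_half_norm_le hn hu0 hu hf
  have hL := lintegral_neg_lap_ne_top hn hu0 hu hf
  set F : Euc n → ENNReal := fun y => ENNReal.ofReal (-lap u y) with hF
  have hFm : AEMeasurable F := (aemeasurable_of_continuousOn_compl_singleton (by omega)
    (continuousOn_lap isOpen_compl_singleton hu).neg).ennreal_ofReal
  set ν : Measure (Euc n) := (volume.restrict (ball 0 (1 / 2))).withDensity F with hν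
  have hνf : IsFiniteMeasure ν := isFiniteMeasure_withDensity hL
  refine ⟨Measure.dirac 0 + ν, C₁ * (C₂ * ENNReal.ofReal (2 ^ (n : ℝ)) + 1), inferInstance,
    ENNReal.mul_ne_top hC₁ (ENNReal.add_ne_top.2 ⟨ENNReal.mul_ne_top hC₂ ENNReal.ofReal_ne_top,
      ENNReal.one_ne_top⟩), fun x hx hx4 => ?_⟩
  have hx0 : 0 < ‖x‖ := norm_pos_iff.2 hx
  have hball : ∀ y ∈ closedBall x (‖x‖ / 2), 0 < ‖y‖ ∧ ‖y‖ < 1 / 2 := by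
    intro y hy
    rw [mem_closedBall, dist_eq_norm] at hy
    have h3 := norm_sub_norm_le x y
    have h4 := norm_sub_norm_le y x
    rw [norm_sub_rev] at h3
    exact ⟨by linarith, by linarith⟩
  have h := hmv {0}ᶜ u x (‖x‖ / 2) isOpen_compl_singleton hu (by positivity)
    (fun y hy => norm_pos_iff.1 (hball y hy).1) (fun y _ => hu0 y)
    (fun y hy => hf y ⟨by simpa using (by linarith [(hball y hy).2] : ‖y‖ < 2),
      norm_pos_iff.1 (hball y hy).1⟩)
  refine h.trans ?_
  rw [mul_assoc]
  refine mul_le_mul' le_rfl ?_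
  have hk : Measurable fun z : Euc n => ‖x - z‖ₑ ^ (-((n : ℝ) - 2)) :=
    (measurable_const.sub measurable_id).enorm.pow_const _
  rw [lintegral_add_measure, lintegral_dirac, sub_zero, hν,
    lintegral_withDensity_eq_lintegral_mul₀ hFm.restrict hk.aemeasurable]
  have e1 : ENNReal.ofReal ((‖x‖ / 2) ^ (-(n : ℝ))) *
      ∫⁻ y in closedBall x (‖x‖ / 2), ENNReal.ofReal (u y) ≤
      C₂ * ENNReal.ofReal (2 ^ (n : ℝ)) * ‖x‖ₑ ^ (-((n : ℝ) - 2)) := by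
    calc _ ≤ ENNReal.ofReal ((‖x‖ / 2) ^ (-(n : ℝ))) * (C₂ * ENNReal.ofReal (‖x‖ ^ 2)) :=
          mul_le_mul' le_rfl (hhalf x hx hx4)
      _ = C₂ * ENNReal.ofReal (2 ^ (n : ℝ)) * ENNReal.ofReal (‖x‖ ^ (-((n : ℝ) - 2))) := by
          rw [mul_left_comm, mul_assoc C₂, ← ENNReal.ofReal_mul (by positivity),
            ← ENNReal.ofReal_mul (by positivity)]
          congr 2
          rw [Real.div_rpow hx0.le (by norm_num), Real.rpow_neg (by norm_num : (0 : ℝ) ≤ 2),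
            show -((n : ℝ) - 2) = -(n : ℝ) + 2 by ring, Real.rpow_add hx0, Real.rpow_two]
          field_simp
      _ ≤ _ := by
          gcongr
          exact ofReal_norm_rpow_neg_le _ (by linarith)
  have e2 : ∫⁻ y in closedBall x (‖x‖ / 2), ‖y - x‖ₑ ^ (-((n : ℝ) - 2)) * F y ≤
      ∫⁻ y in ball (0 : Euc n) (1 / 2), (F * fun z => ‖x - z‖ₑ ^ (-((n : ℝ) - 2))) y := by
    refine (lintegral_mono_set fun y hy => ?_).trans (lintegral_mono fun y => ?_)
    · simpa using (hball y hy).2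
    · rw [Pi.mul_apply, mul_comm, enorm_sub_rev]
  calc _ ≤ C₂ * ENNReal.ofReal (2 ^ (n : ℝ)) * ‖x‖ₑ ^ (-((n : ℝ) - 2)) +
        ∫⁻ y in ball (0 : Euc n) (1 / 2), (F * fun z => ‖x - z‖ₑ ^ (-((n : ℝ) - 2))) y :=
        add_le_add e1 e2
    _ ≤ _ := by
        rw [mul_add]
        refine add_le_add (mul_le_mul' le_self_add le_rfl) ?_
        exact le_mul_of_one_le_left' le_add_self

lemma exists_lintegral_ball_le_sq {n : ℕ} (hn : 3 ≤ n) {w : Euc n → ENNReal} {μ : Measure (Euc n)}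
    [IsFiniteMeasure μ] {C : ENNReal} (hC : C ≠ ⊤)
    (hw : ∀ x, x ≠ 0 → ‖x‖ < 1 / 4 → w x ≤ C * ∫⁻ z, ‖x - z‖ₑ ^ (-((n : ℝ) - 2)) ∂μ) :
    ∃ C' : ENNReal, C' ≠ ⊤ ∧ ∀ (a : Euc n) (ρ : ℝ), 0 < ρ → ball a ρ ⊆ ball 0 (1 / 4) →
      ∫⁻ y in ball a ρ, w y ≤ C' * ENNReal.ofReal (ρ ^ 2) := by
  have : Nonempty (Fin n) := ⟨⟨0, by omega⟩⟩
  have hn3 : (3 : ℝ) ≤ n := by exact_mod_cast hn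
  obtain ⟨K, hK, h⟩ := exists_lintegral_ball_potential_le (n := n) (γ := (n : ℝ) - 2) (by omega)
    (by linarith) (by linarith) μ
  refine ⟨C * K, ENNReal.mul_ne_top hC hK, fun a ρ hρ hsub => ?_⟩
  calc ∫⁻ y in ball a ρ, w y
      ≤ ∫⁻ y in ball a ρ, C * ∫⁻ z, ‖y - z‖ₑ ^ (-((n : ℝ) - 2)) ∂μ := by
        refine lintegral_mono_ae ?_
        filter_upwards [ae_restrict_mem measurableSet_ball,
          ae_restrict_of_ae (compl_mem_ae_iff.2 (measure_singleton (0 : Euc n)))] with y hy hy0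
        exact hw y hy0 (by simpa using hsub hy)
    _ ≤ C * (K * ENNReal.ofReal (ρ ^ ((n : ℝ) - ((n : ℝ) - 2)))) := by
        rw [lintegral_const_mul' _ _ hC]
        exact mul_le_mul' le_rfl (h a ρ hρ)
    _ = _ := by
        rw [sub_sub_cancel, Real.rpow_two, mul_assoc]

lemma rpow_mul_rpow_one_sub_le_add (X Y : ENNReal) {p : ℝ} (hp0 : 0 ≤ p) (hp1 : p ≤ 1) :
    X ^ p * Y ^ (1 - p) ≤ X + Y := by
  have h1p : 0 ≤ 1 - p := by linarith
  calc X ^ p * Y ^ (1 - p) ≤ (X + Y) ^ p * (X + Y) ^ (1 - p) :=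
        mul_le_mul' (ENNReal.rpow_le_rpow le_self_add hp0) (ENNReal.rpow_le_rpow le_add_self h1p)
    _ = X + Y := by
        rw [← ENNReal.rpow_add_of_nonneg _ _ hp0 h1p, add_sub_cancel, ENNReal.rpow_one]

lemma exists_lintegral_mul_potential_rpow_le' {n : ℕ} (hn : 3 ≤ n) {α lam : ℝ} (hα0 : 0 < α)
    (hαn : α < n) (hlam0 : 0 < lam) (hlam1 : lam < ((n : ℝ) - α) / ((n : ℝ) - 2))
    (μ : Measure (Euc n)) [IsFiniteMeasure μ] :
    ∃ C : ENNReal, C ≠ ⊤ ∧ ∀ x : Euc n, ∫⁻ y in ball (0 : Euc n) 1,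
      ‖x - y‖ₑ ^ (-α) * (∫⁻ z, ‖y - z‖ₑ ^ (-((n : ℝ) - 2)) ∂μ) ^ lam ≤ C := by
  have hNe : Nonempty (Fin n) := ⟨⟨0, by omega⟩⟩
  have hn3 : (3 : ℝ) ≤ n := by exact_mod_cast hn
  rw [lt_div_iff₀ (by linarith)] at hlam1
  rcases le_or_gt 1 lam with h1 | h1
  · exact exists_lintegral_mul_potential_rpow_le (by omega) (by linarith) hα0.le h1 (by linarith) μ
  obtain ⟨s, hs0, hs2, hsα, hst⟩ : ∃ s : ℝ, 0 ≤ s ∧ s < 2 ∧ s * lam < α ∧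
      α - s * lam < n * (1 - lam) := by
    have hA : max 0 (n - (n - α) / lam) < min 2 (α / lam) := by
      rw [max_lt_iff, lt_min_iff, lt_min_iff]
      refine ⟨⟨two_pos, by positivity⟩, ?_, ?_⟩
      · rw [sub_lt_comm, lt_div_iff₀ hlam0]
        linarith
      · rw [sub_lt_iff_lt_add, ← add_div, lt_div_iff₀ hlam0]
        nlinarith
    obtain ⟨s, hs1, hs2⟩ := exists_between hA
    rw [max_lt_iff] at hs1
    rw [lt_min_iff] at hs2
    refine ⟨s, hs1.1.le, hs2.1, (lt_div_iff₀ hlam0).1 hs2.2, ?_⟩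
    have h3 := hs1.2
    rw [sub_lt_comm, lt_div_iff₀ hlam0] at h3
    linarith
  set t : ℝ := (α - s * lam) / (1 - lam) with ht
  have h1l : 0 < 1 - lam := by linarith
  have ht0 : 0 ≤ t := div_nonneg (by linarith) h1l.le
  have htn : t < n := by rw [ht, div_lt_iff₀ h1l]; exact hst
  have hα : -α = -s * lam + -t * (1 - lam) := by
    rw [ht]
    field_simp
    ring
  obtain ⟨C₁, hC₁, hI₁⟩ := exists_lintegral_mul_potential_rpow_le (n := n) (γ := (n : ℝ) - 2)
    (s := s) (p := 1) (by omega) (by linarith) hs0 le_rfl (by linarith) μ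
  obtain ⟨C₂, hC₂, hI₂⟩ := exists_lintegral_ball_rpow_neg_le (n := n) (by omega) ht0 htn
  refine ⟨C₁ + C₂, ENNReal.add_ne_top.2 ⟨hC₁, hC₂⟩, fun x => ?_⟩
  have hm : Measurable fun y : Euc n => ‖x - y‖ₑ ^ (-t) :=
    (measurable_const.sub measurable_id).enorm.pow_const _
  calc ∫⁻ y in ball (0 : Euc n) 1,
        ‖x - y‖ₑ ^ (-α) * (∫⁻ z, ‖y - z‖ₑ ^ (-((n : ℝ) - 2)) ∂μ) ^ lam
      ≤ ∫⁻ y in ball (0 : Euc n) 1, (‖x - y‖ₑ ^ (-s) *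
          (∫⁻ z, ‖y - z‖ₑ ^ (-((n : ℝ) - 2)) ∂μ) ^ (1 : ℝ) + ‖x - y‖ₑ ^ (-t)) := by
        refine lintegral_mono_ae (ae_restrict_of_ae ?_)
        filter_upwards [compl_mem_ae_iff.2 (measure_singleton x)] with y hy
        have hxy : ‖x - y‖ₑ ≠ 0 := by
          rw [enorm_ne_zero, sub_ne_zero]
          exact fun h => hy h.symm
        refine le_trans (le_of_eq ?_)
          (rpow_mul_rpow_one_sub_le_add _ _ hlam0.le h1.le)
        rw [ENNReal.rpow_one, ENNReal.mul_rpow_of_nonneg _ _ hlam0.le, ← ENNReal.rpow_mul,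
          ← ENNReal.rpow_mul, hα, ENNReal.rpow_add _ _ hxy enorm_ne_top]
        ring
    _ ≤ C₁ + C₂ := by
        rw [lintegral_add_right _ hm]
        refine add_le_add (hI₁ x) ?_
        have h := hI₂ 0 x 1 one_pos
        simp_rw [enorm_sub_rev _ x] at h
        simpa using h

lemma exists_convolution_bound {n : ℕ} (hn : 3 ≤ n) {α lam : ℝ} (hα0 : 0 < α)
    (hαn : α < n) (hlam0 : 0 < lam) (hlam1 : lam < ((n : ℝ) - α) / ((n : ℝ) - 2))
    {u : Euc n → ℝ} (hu0 : ∀ x, 0 ≤ u x) (hint : Integrable fun y => u y ^ lam)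
    {μ : Measure (Euc n)} [IsFiniteMeasure μ] {C : ENNReal} (hC : C ≠ ⊤)
    (hw : ∀ x, x ≠ 0 → ‖x‖ < 1 / 4 →
      ENNReal.ofReal (u x) ≤ C * ∫⁻ z, ‖x - z‖ₑ ^ (-((n : ℝ) - 2)) ∂μ) :
    ∃ K : ℝ, 0 ≤ K ∧ ∀ x : Euc n, ‖x‖ < 1 / 8 → ∫ y, ‖x - y‖ ^ (-α) * u y ^ lam ≤ K := by
  have hNe : Nonempty (Fin n) := ⟨⟨0, by omega⟩⟩
  obtain ⟨D, hD, hI⟩ := exists_lintegral_mul_potential_rpow_le' hn hα0 hαn hlam0 hlam1 μ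
  set L := ∫⁻ y, ENNReal.ofReal (u y ^ lam) with hL
  have hLt : L ≠ ⊤ := hint.lintegral_lt_top.ne
  have h8 : ENNReal.ofReal (8 ^ α) * L ≠ ⊤ := ENNReal.mul_ne_top ENNReal.ofReal_ne_top hLt
  have hCl : C ^ lam ≠ ⊤ := ENNReal.rpow_ne_top_of_nonneg hlam0.le hC
  have hT : C ^ lam * D + ENNReal.ofReal (8 ^ α) * L ≠ ⊤ :=
    ENNReal.add_ne_top.2 ⟨ENNReal.mul_ne_top hCl hD, h8⟩
  refine ⟨(C ^ lam * D + ENNReal.ofReal (8 ^ α) * L).toReal, ENNReal.toReal_nonneg,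
    fun x hx => (Real.le_norm_self _).trans
    ((norm_integral_le_lintegral_norm _).trans (ENNReal.toReal_mono hT ?_))⟩
  rw [← lintegral_add_compl _ (measurableSet_ball (x := (0 : Euc n)) (ε := 1 / 4))]
  refine add_le_add ?_ ?_
  · calc ∫⁻ y in ball (0 : Euc n) (1 / 4), ENNReal.ofReal ‖‖x - y‖ ^ (-α) * u y ^ lam‖
        ≤ ∫⁻ y in ball (0 : Euc n) (1 / 4), C ^ lam * (‖x - y‖ₑ ^ (-α) *
            (∫⁻ z, ‖y - z‖ₑ ^ (-((n : ℝ) - 2)) ∂μ) ^ lam) := by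
          refine lintegral_mono_ae ?_
          filter_upwards [ae_restrict_mem measurableSet_ball,
            ae_restrict_of_ae (compl_mem_ae_iff.2 (measure_singleton (0 : Euc n)))] with y hy hy0
          have h1 := hw y hy0 (by simpa using hy)
          have hnn : 0 ≤ u y ^ lam := Real.rpow_nonneg (hu0 y) _
          rw [Real.norm_of_nonneg (mul_nonneg (by positivity) hnn),
            ENNReal.ofReal_mul (by positivity), ← ENNReal.ofReal_rpow_of_nonneg (hu0 y) hlam0.le,
            mul_left_comm, ← ENNReal.mul_rpow_of_nonneg _ _ hlam0.le]
          exact mul_le_mul' (ofReal_norm_rpow_neg_le _ hα0.le) (ENNReal.rpow_le_rpow h1 hlam0.le)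
      _ ≤ C ^ lam * D := by
          rw [lintegral_const_mul' _ _ hCl]
          refine mul_le_mul' le_rfl ((lintegral_mono_set ?_).trans (hI x))
          exact ball_subset_ball (by norm_num)
  · calc ∫⁻ y in (ball (0 : Euc n) (1 / 4))ᶜ, ENNReal.ofReal ‖‖x - y‖ ^ (-α) * u y ^ lam‖
        ≤ ∫⁻ y in (ball (0 : Euc n) (1 / 4))ᶜ,
            ENNReal.ofReal (8 ^ α) * ENNReal.ofReal (u y ^ lam) := by
          refine setLIntegral_mono' measurableSet_ball.compl fun y hy => ?_
          have hnn : 0 ≤ u y ^ lam := Real.rpow_nonneg (hu0 y) _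
          rw [Real.norm_of_nonneg (mul_nonneg (by positivity) hnn),
            ← ENNReal.ofReal_mul (by positivity)]
          refine ENNReal.ofReal_le_ofReal (mul_le_mul_of_nonneg_right ?_ hnn)
          have hy4 : 1 / 4 ≤ ‖y‖ := by simpa using hy
          have h3 := norm_sub_norm_le y x
          rw [norm_sub_rev] at h3
          rw [show (8 : ℝ) ^ α = (1 / 8 : ℝ) ^ (-α) by
            rw [one_div, Real.inv_rpow (by norm_num), Real.rpow_neg (by norm_num), inv_inv]]
          exact Real.rpow_le_rpow_of_nonpos (by norm_num) (by linarith) (by linarith)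
      _ ≤ _ := by
          rw [lintegral_const_mul' _ _ ENNReal.ofReal_ne_top]
          exact mul_le_mul' le_rfl (setLIntegral_le_lintegral _ _)

lemma exists_lintegral_newton_split_le {n : ℕ} (hn : 3 ≤ n) : ∃ C : ENNReal, C ≠ ⊤ ∧
    ∀ (a : Euc n) (ρ δ : ℝ) (F : Euc n → ENNReal) (B : ENNReal), 0 < δ → B ≠ ⊤ →
      (∀ y ∈ closedBall a ρ, F y ≤ B) →
      ∫⁻ y in closedBall a ρ, ‖y - a‖ₑ ^ (-((n : ℝ) - 2)) * F y ≤
        C * ENNReal.ofReal (δ ^ 2) * B +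
          ENNReal.ofReal (δ ^ (-((n : ℝ) - 2))) * ∫⁻ y in closedBall a ρ, F y := by
  have hn3 : (3 : ℝ) ≤ n := by exact_mod_cast hn
  obtain ⟨C, hC, hI⟩ := exists_lintegral_ball_rpow_neg_le (n := n) (β := (n : ℝ) - 2) (by omega)
    (by linarith) (by linarith)
  refine ⟨C, hC, fun a ρ δ F B hδ hB hF => ?_⟩
  have hk : Measurable ((ball a δ).indicator fun y => ‖y - a‖ₑ ^ (-((n : ℝ) - 2))) :=
    ((measurable_id.sub measurable_const).enorm.pow_const _).indicator measurableSet_ball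
  calc ∫⁻ y in closedBall a ρ, ‖y - a‖ₑ ^ (-((n : ℝ) - 2)) * F y
      ≤ ∫⁻ y in closedBall a ρ,
          ((ball a δ).indicator (fun y => ‖y - a‖ₑ ^ (-((n : ℝ) - 2))) y * B +
            ENNReal.ofReal (δ ^ (-((n : ℝ) - 2))) * F y) := by
        refine setLIntegral_mono' measurableSet_closedBall fun y hy => ?_
        by_cases hyδ : y ∈ ball a δ
        · rw [indicator_of_mem hyδ]
          exact (mul_le_mul' le_rfl (hF y hy)).trans le_self_add
        · rw [indicator_of_notMem hyδ, zero_mul, zero_add]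
          refine mul_le_mul' ?_ le_rfl
          rw [mem_ball, dist_eq_norm, not_lt] at hyδ
          have hpos : 0 < ‖y - a‖ := hδ.trans_le hyδ
          rw [← ofReal_norm, ENNReal.ofReal_rpow_of_pos hpos]
          exact ENNReal.ofReal_le_ofReal
            (Real.rpow_le_rpow_of_nonpos hδ hyδ (by linarith))
    _ = (∫⁻ y in closedBall a ρ,
          (ball a δ).indicator (fun y => ‖y - a‖ₑ ^ (-((n : ℝ) - 2))) y) * B +
          ENNReal.ofReal (δ ^ (-((n : ℝ) - 2))) * ∫⁻ y in closedBall a ρ, F y := by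
        rw [lintegral_add_left (hk.mul_const B), lintegral_mul_const' _ _ hB,
          lintegral_const_mul' _ _ ENNReal.ofReal_ne_top]
    _ ≤ _ := by
        refine add_le_add (mul_le_mul' ?_ le_rfl) le_rfl
        refine (setLIntegral_le_lintegral _ _).trans ?_
        rw [lintegral_indicator measurableSet_ball]
        have h := hI a a δ hδ
        rwa [sub_sub_cancel, Real.rpow_two] at h

lemma eventually_lintegral_ball_le {n : ℕ} (hn : 1 ≤ n) {F : Euc n → ENNReal} {R : ℝ} (hR : 0 < R)
    (hF : ∫⁻ y in ball (0 : Euc n) R, F y ≠ ⊤) {η : ENNReal} (hη : η ≠ 0) :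
    ∃ R₀ : ℝ, 0 < R₀ ∧ ∫⁻ y in ball (0 : Euc n) R₀, F y ≤ η := by
  obtain ⟨δ, hδ, h⟩ := exists_pos_setLIntegral_lt_of_measure_lt hF hη
  have : Nonempty (Fin n) := ⟨⟨0, hn⟩⟩
  have ht : Tendsto (fun r : ℝ => ENNReal.ofReal (r ^ n) * volume (ball (0 : Euc n) 1)) (𝓝[>] 0)
      (𝓝 0) := by
    have h1 : Tendsto (fun r : ℝ => ENNReal.ofReal (r ^ n)) (𝓝[>] 0) (𝓝 0) := by
      have h2 : Tendsto (fun r : ℝ => r ^ n) (𝓝[>] 0) (𝓝 0) := by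
        have := (continuous_pow (M := ℝ) n).tendsto 0
        rw [zero_pow (by omega)] at this
        exact this.mono_left nhdsWithin_le_nhds
      simpa using ENNReal.tendsto_ofReal h2
    simpa using ENNReal.Tendsto.mul_const h1 (Or.inr measure_ball_lt_top.ne)
  obtain ⟨r, hrδ, hr0, hrR⟩ := ((ht.eventually (gt_mem_nhds hδ)).and
    (Ioo_mem_nhdsGT hR)).exists
  have hr0' : 0 < r := hr0
  refine ⟨r, hr0, ?_⟩
  have hsub : ball (0 : Euc n) r ⊆ ball 0 R := ball_subset_ball hrR.le
  have h3 := h (ball 0 r) (by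
    rw [Measure.restrict_apply measurableSet_ball, inter_eq_left.2 hsub,
      Measure.addHaar_ball _ _ hr0'.le, finrank_euclideanSpace_fin]
    exact hrδ)
  rw [Measure.restrict_restrict measurableSet_ball, inter_eq_left.2 hsub] at h3
  exact h3.le

lemma exists_bound_of_doubling {n : ℕ} (hn : 3 ≤ n) {u : Euc n → ℝ} (hu0 : ∀ x, 0 ≤ u x)
    (hu : ContDiffOn ℝ 2 u {0}ᶜ) (hf : ∀ x ∈ ball (0 : Euc n) 2 \ {0}, 0 ≤ -lap u x)
    {K : ℝ} (hK : 0 ≤ K)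
    (hfK : ∀ x, x ≠ 0 → ‖x‖ < 1 / 8 → -lap u x ≤ K * u x ^ ((n : ℝ) / ((n : ℝ) - 2)))
    {C' : ENNReal} (hC' : C' ≠ ⊤)
    (hball : ∀ (a : Euc n) (ρ : ℝ), 0 < ρ → ball a ρ ⊆ ball 0 (1 / 4) →
      ∫⁻ y in ball a ρ, ENNReal.ofReal (u y) ≤ C' * ENNReal.ofReal (ρ ^ 2)) :
    ∃ A R : ℝ, 0 < R ∧ ∀ x : Euc n, x ≠ 0 → ‖x‖ < R → u x ≤ A * ‖x‖ ^ (-((n : ℝ) - 2)) := by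
  have hn3 : (3 : ℝ) ≤ n := by exact_mod_cast hn
  set m : ℝ := (n : ℝ) - 2 with hm
  have hm0 : 0 < m := by rw [hm]; linarith
  have hnm : (n : ℝ) = m + 2 := by rw [hm]; ring
  obtain ⟨C₁, hC₁, hmv⟩ := exists_mean_value_bound hn
  obtain ⟨C₃, hC₃, hsplit⟩ := exists_lintegral_newton_split_le hn
  have hL := lintegral_neg_lap_ne_top hn hu0 hu hf
  have toR : ∀ C : ENNReal, C ≠ ⊤ → ∃ c : ℝ, 0 ≤ c ∧ C = ENNReal.ofReal c := fun C hC =>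
    ⟨C.toReal, ENNReal.toReal_nonneg, (ENNReal.ofReal_toReal hC).symm⟩
  obtain ⟨c₁, hc₁, rfl⟩ := toR C₁ hC₁
  obtain ⟨c₂, hc₂, rfl⟩ := toR C' hC'
  obtain ⟨c₃, hc₃, rfl⟩ := toR C₃ hC₃
  set B : ℝ := c₁ * c₃ * (K * 2 ^ (n : ℝ)) with hB
  have hB0 : 0 ≤ B := by positivity
  set κ : ℝ := 1 / (2 * (B + 1)) with hκ
  have hκ0 : 0 < κ := by positivity
  have hBκ : B * κ ^ 2 ≤ 1 / 4 := by
    rw [hκ, div_pow, one_pow, mul_one_div, div_le_div_iff₀ (by positivity) (by norm_num)]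
    nlinarith
  set η : ℝ := κ ^ m / (4 * (c₁ + 1)) with hη
  have hη0 : 0 < η := by positivity
  have hηκ : c₁ * (κ ^ (-m) * η) ≤ 1 / 4 := by
    have : κ ^ (-m) * η = 1 / (4 * (c₁ + 1)) := by
      rw [hη, Real.rpow_neg hκ0.le]
      field_simp
    rw [this, mul_one_div, div_le_div_iff₀ (by positivity) (by norm_num)]
    linarith
  obtain ⟨R, hR, hRη⟩ := eventually_lintegral_ball_le (by omega) (by norm_num) hL
    (ENNReal.ofReal_pos.2 hη0).ne'
  refine ⟨2 ^ m * (2 * (4 * c₁ * c₂)) * 2 ^ m, min (R / 2) (1 / 16),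
    lt_min (by linarith) (by norm_num), fun x hx hxR => ?_⟩
  have hx0 : 0 < ‖x‖ := norm_pos_iff.2 hx
  have hx1 : ‖x‖ < R / 2 := hxR.trans_le (min_le_left _ _)
  have hx2 : ‖x‖ < 1 / 16 := hxR.trans_le (min_le_right _ _)
  set r : ℝ := ‖x‖ / 2 with hr
  have hr0 : 0 < r := by positivity
  have hin : ∀ y ∈ closedBall x r, 0 < ‖y‖ ∧ ‖y‖ < 2 * ‖x‖ := by
    intro y hy
    rw [mem_closedBall, dist_eq_norm] at hy
    have h3 := norm_sub_norm_le x y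
    have h4 := norm_sub_norm_le y x
    rw [norm_sub_rev] at h3
    exact ⟨by linarith, by linarith⟩
  suffices h : r ^ m * u x ≤ 2 ^ m * (2 * (4 * c₁ * c₂)) by
    have h1 : 0 < ‖x‖ ^ m := by positivity
    rw [Real.rpow_neg hx0.le, ← div_eq_mul_inv, le_div_iff₀ h1]
    rw [hr, Real.div_rpow hx0.le (by norm_num), div_mul_eq_mul_div,
      div_le_iff₀ (by positivity)] at h
    linarith
  rcases (hu0 x).eq_or_lt with hux | hux
  · rw [← hux, mul_zero]
    positivity
  have hcont : ContinuousOn (fun ξ => (r - ‖ξ - x‖) ^ m * u ξ) (closedBall x r) := by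
    refine ContinuousOn.mul ?_ (hu.continuousOn.mono fun y hy => norm_pos_iff.1 (hin y hy).1)
    exact (Continuous.rpow_const (by fun_prop) fun _ => Or.inr hm0.le).continuousOn
  obtain ⟨ξ, hξ, hmax⟩ := (isCompact_closedBall x r).exists_isMaxOn
    ⟨x, mem_closedBall_self hr0.le⟩ hcont
  have hmax' : ∀ y ∈ closedBall x r, (r - ‖y - x‖) ^ m * u y ≤ (r - ‖ξ - x‖) ^ m * u ξ :=
    fun y hy => hmax hy
  have hxM := hmax' x (mem_closedBall_self hr0.le)
  rw [sub_self, norm_zero, sub_zero] at hxM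
  have hξr : ‖ξ - x‖ ≤ r := by rwa [mem_closedBall, dist_eq_norm] at hξ
  set d : ℝ := r - ‖ξ - x‖ with hd
  set U : ℝ := u ξ with hU
  have hMpos : 0 < d ^ m * U := lt_of_lt_of_le (by positivity) hxM
  have hd0 : 0 < d := by
    rcases (sub_nonneg.2 hξr).eq_or_lt with h | h
    · rw [hd, ← h, Real.zero_rpow hm0.ne', zero_mul] at hMpos
      exact absurd hMpos (lt_irrefl _)
    · exact h
  have hU0 : 0 < U := pos_of_mul_pos_right hMpos (by positivity)
  refine hxM.trans ?_
  set ρ : ℝ := d / 2 with hρ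
  have hρ0 : 0 < ρ := by positivity
  have hsub : closedBall ξ ρ ⊆ closedBall x r := by
    intro y hy
    rw [mem_closedBall] at hy ⊢
    have := dist_triangle y ξ x
    rw [dist_eq_norm ξ x] at this
    linarith
  have hdouble : ∀ y ∈ closedBall ξ ρ, u y ≤ 2 ^ m * U := by
    intro y hy
    have h1 := hmax' y (hsub hy)
    have h2 : ρ ≤ r - ‖y - x‖ := by
      rw [mem_closedBall] at hy
      have := dist_triangle y ξ x
      rw [dist_eq_norm ξ x, dist_eq_norm y x] at this
      linarith
    have h3 : ρ ^ m * u y ≤ (r - ‖y - x‖) ^ m * u y :=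
      mul_le_mul_of_nonneg_right (Real.rpow_le_rpow hρ0.le h2 hm0.le) (hu0 y)
    have h4 : d ^ m = ρ ^ m * 2 ^ m := by
      rw [← Real.mul_rpow hρ0.le (by norm_num), hρ]
      congr 1
      ring
    rw [h4, mul_assoc] at h1
    exact le_of_mul_le_mul_left (h3.trans h1) (by positivity)
  have hFle : ∀ y ∈ closedBall ξ ρ,
      ENNReal.ofReal (-lap u y) ≤ ENNReal.ofReal (K * (2 ^ (n : ℝ) * U ^ ((n : ℝ) / m))) := by
    intro y hy
    have h1 := hin y (hsub hy)
    refine ENNReal.ofReal_le_ofReal ((hfK y (norm_pos_iff.1 h1.1) (by linarith)).trans ?_)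
    have h2 : u y ^ ((n : ℝ) / m) ≤ (2 ^ m * U) ^ ((n : ℝ) / m) :=
      Real.rpow_le_rpow (hu0 y) (hdouble y hy) (by positivity)
    rw [Real.mul_rpow (by positivity) hU0.le, ← Real.rpow_mul (by norm_num),
      mul_div_cancel₀ _ hm0.ne'] at h2
    exact mul_le_mul_of_nonneg_left h2 hK
  set δ : ℝ := κ * U ^ (-1 / m) with hδ
  have hδ0 : 0 < δ := by positivity
  have h1 := hmv {0}ᶜ u ξ ρ isOpen_compl_singleton hu hρ0
    (fun y hy => norm_pos_iff.1 (hin y (hsub hy)).1) (fun y _ => hu0 y)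
    (fun y hy => hf y ⟨by simpa using (by linarith [(hin y (hsub hy)).2] : ‖y‖ < 2),
      norm_pos_iff.1 (hin y (hsub hy)).1⟩)
  have h2 := hsplit ξ ρ δ (fun y => ENNReal.ofReal (-lap u y)) _ hδ0 ENNReal.ofReal_ne_top hFle
  have h3 : ∫⁻ y in closedBall ξ ρ, ENNReal.ofReal (-lap u y) ≤ ENNReal.ofReal η :=
    (lintegral_mono_set fun y hy => by
      simpa using (by linarith [(hin y (hsub hy)).2] : ‖y‖ < R)).trans hRη
  have h4 : ∫⁻ y in closedBall ξ ρ, ENNReal.ofReal (u y) ≤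
      ENNReal.ofReal c₂ * ENNReal.ofReal ((2 * ρ) ^ 2) := by
    refine (lintegral_mono_set (closedBall_subset_ball (by linarith))).trans
      (hball ξ (2 * ρ) (by positivity) fun y hy => ?_)
    have h5 : y ∈ closedBall x r := by
      rw [mem_ball] at hy
      rw [mem_closedBall]
      have := dist_triangle y ξ x
      rw [dist_eq_norm ξ x] at this
      linarith
    simpa using (by linarith [(hin y h5).2] : ‖y‖ < 1 / 4)
  have h5 : ENNReal.ofReal U ≤ ENNReal.ofReal (c₁ * (ρ ^ (-(n : ℝ)) * (c₂ * (2 * ρ) ^ 2) +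
      (c₃ * δ ^ 2 * (K * (2 ^ (n : ℝ) * U ^ ((n : ℝ) / m))) + δ ^ (-m) * η))) := by
    refine h1.trans ?_
    rw [ENNReal.ofReal_mul hc₁, ENNReal.ofReal_add (by positivity) (by positivity),
      ENNReal.ofReal_add (by positivity) (by positivity), ENNReal.ofReal_mul (by positivity),
      ENNReal.ofReal_mul hc₂, ENNReal.ofReal_mul (by positivity), ENNReal.ofReal_mul hc₃,
      ENNReal.ofReal_mul (p := δ ^ (-m)) (by positivity)]
    exact mul_le_mul' le_rfl (add_le_add (mul_le_mul' le_rfl h4)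
      (h2.trans (add_le_add le_rfl (mul_le_mul' le_rfl h3))))
  rw [ENNReal.ofReal_le_ofReal_iff (by positivity)] at h5
  have e1 : ρ ^ (-(n : ℝ)) * (c₂ * (2 * ρ) ^ 2) = 4 * c₂ * ρ ^ (-m) := by
    rw [hnm, show -m = -(m + 2) + 2 by ring, Real.rpow_add hρ0, Real.rpow_two]
    ring
  have e2 : δ ^ 2 * U ^ ((n : ℝ) / m) = κ ^ 2 * U := by
    rw [hδ, mul_pow, ← Real.rpow_two (U ^ _), ← Real.rpow_mul hU0.le, mul_assoc,
      ← Real.rpow_add hU0, show -1 / m * 2 + (n : ℝ) / m = 1 by rw [hnm]; field_simp; ring,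
      Real.rpow_one]
  have e3 : δ ^ (-m) = κ ^ (-m) * U := by
    rw [hδ, Real.mul_rpow hκ0.le (by positivity), ← Real.rpow_mul hU0.le,
      show -1 / m * -m = 1 by field_simp, Real.rpow_one]
  have h6 : U ≤ 4 * c₁ * c₂ * ρ ^ (-m) + B * κ ^ 2 * U + c₁ * (κ ^ (-m) * η) * U := by
    refine h5.trans (le_of_eq ?_)
    rw [e1, e3, hB, show c₃ * δ ^ 2 * (K * (2 ^ (n : ℝ) * U ^ ((n : ℝ) / m))) =
      c₃ * K * 2 ^ (n : ℝ) * (δ ^ 2 * U ^ ((n : ℝ) / m)) by ring, e2]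
    ring
  have h7 : U ≤ 2 * (4 * c₁ * c₂) * ρ ^ (-m) := by
    have h8 := mul_le_mul_of_nonneg_right hBκ hU0.le
    have h9 := mul_le_mul_of_nonneg_right hηκ hU0.le
    linarith
  calc d ^ m * U ≤ d ^ m * (2 * (4 * c₁ * c₂) * ρ ^ (-m)) := by gcongr
    _ = 2 ^ m * (2 * (4 * c₁ * c₂)) := by
      rw [show d = 2 * ρ by rw [hρ]; ring, Real.mul_rpow (by norm_num) hρ0.le,
        Real.rpow_neg hρ0.le]
      field_simp

theorem stmt2 (n : ℕ) (hn : 3 ≤ n) (α lam sig : ℝ)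
    (hα0 : 0 < α) (hαn : α < n)
    (hlam0 : 0 < lam) (hlam1 : lam < ((n : ℝ) - α) / ((n : ℝ) - 2))
    (hsig : sig = (n : ℝ) / ((n : ℝ) - 2))
    (u : Euc n → ℝ) (hu : IsCPSolution n α lam sig u) :
    u =O[𝓝[≠] (0 : Euc n)] fun x => ‖x‖ ^ (-((n : ℝ) - 2)) := by
  obtain ⟨hu0, hu2, hint, hineq⟩ := hu
  have hf : ∀ x ∈ ball (0 : Euc n) 2 \ {0}, 0 ≤ -lap u x := fun x hx => (hineq x hx).1
  obtain ⟨μ, C, hμ, hC, hpot⟩ := exists_potential_bound hn hu0 hu2 hf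
  obtain ⟨C', hC', hball⟩ := exists_lintegral_ball_le_sq hn hC hpot
  obtain ⟨K, hK, hconv⟩ := exists_convolution_bound hn hα0 hαn hlam0 hlam1 hu0 hint hC hpot
  obtain ⟨A, R, hR, hA⟩ := exists_bound_of_doubling hn hu0 hu2 hf hK (fun x hx hx8 => by
    rw [← hsig]
    exact (hineq x ⟨by simpa using (by linarith : ‖x‖ < 2), hx⟩).2.trans
      (mul_le_mul_of_nonneg_right (hconv x hx8) (Real.rpow_nonneg (hu0 x) _))) hC' hball
  refine IsBigO.of_bound A ?_
  filter_upwards [self_mem_nhdsWithin, mem_nhdsWithin_of_mem_nhds (ball_mem_nhds 0 hR)]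
    with x hx hxR
  rw [Real.norm_of_nonneg (hu0 x), Real.norm_of_nonneg (by positivity)]
  exact hA x hx (by simpa using hxR)
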